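/- There exists a universal constant C > 0 such that the following holds. Let T ∈ ℕ, let M ⊆ M⁺ be a model class, let δ > 0, and let M̄ ∈ M⁺ be a model such that f^{M̄}(π_{M̄}) ≤ f^M(π_M) + δ for all M ∈ M. Then the minimax expected regret over the enlarged class satisfies: inf over T-round regret algorithms p' of sup_{M*∈M∪{M̄}} E^{M*,p'}[Reg(T)] ≤ C·log T · ( inf over T-round regret algorithms p of sup_{M*∈M} E^{M*,p}[Reg(T)] ) + C·(√T + δ·T). -/

import Mathlib

open MeasureTheory ProbabilityTheory
open scoped ENNReal NNReal

noncomputable section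

/-- The squared Hellinger distance between two measures, computed with respect to the
common dominating measure `P + Q`. -/
def sqHellinger {Z : Type} [MeasurableSpace Z] (P Q : Measure Z) : ℝ :=
  ∫ z, (Real.sqrt ((P.rnDeriv (P + Q)) z).toReal
      - Real.sqrt ((Q.rnDeriv (P + Q)) z).toReal) ^ 2 ∂(P + Q)

/-- A model: a Markov kernel from decisions to distributions over reward/observation pairs,
with rewards supported in `[0,1]`, together with a maximizing decision
(whose existence is assumed). -/
structure Model (X Y : Type) [MeasurableSpace X] [MeasurableSpace Y] where
  k : Kernel X (ℝ × Y)
  markov : IsMarkovKernel k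
  reward01 : ∀ x : X, (k x) {ry : ℝ × Y | ry.1 ∈ Set.Icc (0 : ℝ) 1}ᶜ = 0
  opt : X
  opt_max : ∀ x : X, (∫ ry, ry.1 ∂(k x)) ≤ ∫ ry, ry.1 ∂(k opt)

variable {X Y : Type} [MeasurableSpace X] [MeasurableSpace Y]

/-- Mean reward `f^M(x)`. -/
def fm (M : Model X Y) (x : X) : ℝ := ∫ ry, ry.1 ∂(M.k x)

/-- Suboptimality gap `g^M(x) = f^M(π_M) - f^M(x)`. -/
def gap (M : Model X Y) (x : X) : ℝ := fm M M.opt - fm M x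

/-- Expected suboptimality of a decision distribution `p` under model `M`. -/
def avgGap (p : ProbabilityMeasure X) (M : Model X Y) : ℝ :=
  ∫ x, gap M x ∂(p : Measure X)

/-- Expected squared Hellinger distance between `M` and `Mbar` under `p`. -/
def avgHell (p : ProbabilityMeasure X) (M Mbar : Model X Y) : ℝ :=
  ∫ x, sqHellinger (M.k x) (Mbar.k x) ∂(p : Measure X)

/-- The constrained regret Decision-Estimation Coefficient. -/
def decC (ε : ℝ) (𝓜 : Set (Model X Y)) (Mbar : Model X Y) : ℝ :=
  ⨅ p : ProbabilityMeasure X,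
    ⨆ M ∈ {M ∈ 𝓜 | avgHell p M Mbar ≤ ε ^ 2}, avgGap p M

/-- The offset regret Decision-Estimation Coefficient. -/
def decO (γ : ℝ) (𝓜 : Set (Model X Y)) (Mbar : Model X Y) : ℝ :=
  ⨅ p : ProbabilityMeasure X, ⨆ M ∈ 𝓜, (avgGap p M - γ * avgHell p M Mbar)

/-- The constrained PAC Decision-Estimation Coefficient. -/
def decCpac (ε : ℝ) (𝓜 : Set (Model X Y)) (Mbar : Model X Y) : ℝ :=
  ⨅ p : ProbabilityMeasure X, ⨅ q : ProbabilityMeasure X,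
    ⨆ M ∈ {M ∈ 𝓜 | avgHell q M Mbar ≤ ε ^ 2}, avgGap p M

/-- The offset PAC Decision-Estimation Coefficient. -/
def decOpac (γ : ℝ) (𝓜 : Set (Model X Y)) (Mbar : Model X Y) : ℝ :=
  ⨅ p : ProbabilityMeasure X, ⨅ q : ProbabilityMeasure X,
    ⨆ M ∈ 𝓜, (avgGap p M - γ * avgHell q M Mbar)

/-- A distribution over a class of models, represented as a probability space together with
a (measurable) family of models belonging to the class. -/
structure ClassDist (X Y : Type) [MeasurableSpace X] [MeasurableSpace Y]
    (𝓜 : Set (Model X Y)) where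
  (Ω : Type)
  [iΩ : MeasurableSpace Ω]
  (ν : Measure Ω)
  (prob : IsProbabilityMeasure ν)
  (m : Ω → Model X Y)
  (mem : ∀ ω, m ω ∈ 𝓜)
  (meas : ∀ (x : X) (A : Set (ℝ × Y)), MeasurableSet A → Measurable fun ω => (m ω).k x A)

attribute [instance] ClassDist.iΩ

/-- `Mbar` is the mixture (mean) model of the class distribution `D`. -/
def IsMixtureOf {𝓜 : Set (Model X Y)} (D : ClassDist X Y 𝓜) (Mbar : Model X Y) : Prop :=
  ∀ (x : X) (A : Set (ℝ × Y)), MeasurableSet A →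
    Mbar.k x A = ∫⁻ ω, (D.m ω).k x A ∂D.ν

/-- The convex hull of a model class: all mixtures of models in the class. -/
def convHull (𝓜 : Set (Model X Y)) : Set (Model X Y) :=
  {Mbar | ∃ D : ClassDist X Y 𝓜, IsMixtureOf D Mbar}

/-- `dec^c_ε(𝓜) = sup_{Mbar ∈ co(𝓜)} dec^c_ε(𝓜 ∪ {Mbar}, Mbar)`. -/
def decCfull (ε : ℝ) (𝓜 : Set (Model X Y)) : ℝ :=
  ⨆ Mbar ∈ convHull 𝓜, decC ε (𝓜 ∪ {Mbar}) Mbar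

/-- `dec^{c,pac}_ε(𝓜) = sup_{Mbar ∈ co(𝓜)} dec^{c,pac}_ε(𝓜, Mbar)`. -/
def decCpacFull (ε : ℝ) (𝓜 : Set (Model X Y)) : ℝ :=
  ⨆ Mbar ∈ convHull 𝓜, decCpac ε 𝓜 Mbar

/-- The localized subclass `𝓜_α(Mbar)`. -/
def locClass (α : ℝ) (𝓜 : Set (Model X Y)) (Mbar : Model X Y) : Set (Model X Y) :=
  {M ∈ 𝓜 | fm M M.opt ≤ fm Mbar Mbar.opt + α}

/-- The greedy PAC Decision-Estimation Coefficient. -/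
def decGpac (ε : ℝ) (𝓜 : Set (Model X Y)) (Mbar : Model X Y) : ℝ :=
  ⨅ q : ProbabilityMeasure X,
    ⨆ M ∈ {M ∈ 𝓜 | avgHell q M Mbar ≤ ε ^ 2}, (fm M M.opt - fm M Mbar.opt)

/-- The PAC DEC with Hellinger constraints under both `p` and `q`. -/
def decAlt (ε : ℝ) (𝓜 : Set (Model X Y)) (Mbar : Model X Y) : ℝ :=
  ⨅ p : ProbabilityMeasure X, ⨅ q : ProbabilityMeasure X,
    ⨆ M ∈ {M ∈ 𝓜 | avgHell p M Mbar ≤ ε ^ 2 ∧ avgHell q M Mbar ≤ ε ^ 2}, avgGap p M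

/-- Expected squared Hellinger distance to a randomized reference model. -/
def randAvgHell {𝓜 : Set (Model X Y)} (p : ProbabilityMeasure X) (M : Model X Y)
    (D : ClassDist X Y 𝓜) : ℝ :=
  ∫ ω, avgHell p M (D.m ω) ∂D.ν

/-- The randomized offset regret DEC. -/
def decOrand (γ : ℝ) {𝓜₀ : Set (Model X Y)} (𝓜 : Set (Model X Y))
    (D : ClassDist X Y 𝓜₀) : ℝ :=
  ⨅ p : ProbabilityMeasure X, ⨆ M ∈ 𝓜, (avgGap p M - γ * randAvgHell p M D)

/-- The randomized constrained regret DEC. -/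
def decCrand (ε : ℝ) {𝓜₀ : Set (Model X Y)} (𝓜 : Set (Model X Y))
    (D : ClassDist X Y 𝓜₀) : ℝ :=
  ⨅ p : ProbabilityMeasure X,
    ⨆ M ∈ {M ∈ 𝓜 | randAvgHell p M D ≤ ε ^ 2}, avgGap p M

/-- The randomized offset PAC DEC. -/
def decOpacRand (γ : ℝ) {𝓜₀ : Set (Model X Y)} (𝓜 : Set (Model X Y))
    (D : ClassDist X Y 𝓜₀) : ℝ :=
  ⨅ p : ProbabilityMeasure X, ⨅ q : ProbabilityMeasure X,
    ⨆ M ∈ 𝓜, (avgGap p M - γ * randAvgHell q M D)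

/-- The Bayesian offset regret DEC (sup over priors of the inf over decision distributions). -/
def bayesDecO (γ : ℝ) (𝓜 : Set (Model X Y)) (Mbar : Model X Y) : ℝ :=
  sSup {x : ℝ | ∃ D : ClassDist X Y 𝓜,
    x = ⨅ p : ProbabilityMeasure X,
          ∫ ω, (avgGap p (D.m ω) - γ * avgHell p (D.m ω) Mbar) ∂D.ν}

/-- The Bayesian offset PAC DEC. -/
def bayesDecOpac (γ : ℝ) (𝓜 : Set (Model X Y)) (Mbar : Model X Y) : ℝ :=
  sSup {x : ℝ | ∃ D : ClassDist X Y 𝓜,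
    x = ⨅ p : ProbabilityMeasure X, ⨅ q : ProbabilityMeasure X,
          ∫ ω, (avgGap p (D.m ω) - γ * avgHell q (D.m ω) Mbar) ∂D.ν}

/-- Histories of interaction. -/
abbrev Hist (X Y : Type) (n : ℕ) := Fin n → X × ℝ × Y

/-- Prefix of a history. -/
def hPrefix {n : ℕ} (h : Hist X Y n) (t : ℕ) (ht : t ≤ n) : Hist X Y t :=
  fun i => h (Fin.castLE ht i)

/-- Law of the interaction history under model `M` and selection rule `sel`. -/
def histLaw (M : Model X Y) (sel : (n : ℕ) → Hist X Y n → Measure X) :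
    (n : ℕ) → Measure (Hist X Y n)
  | 0 => Measure.dirac (fun i => i.elim0)
  | n + 1 =>
    (histLaw M sel n).bind fun h =>
      (sel n h).bind fun x =>
        (M.k x).bind fun ry => Measure.dirac (Fin.snoc h (x, ry))

/-- A regret-minimization algorithm: a sequence of probability kernels from histories
to decisions. -/
structure RegAlg (X Y : Type) [MeasurableSpace X] [MeasurableSpace Y] where
  sel : (n : ℕ) → Hist X Y n → Measure X
  prob : ∀ n h, IsProbabilityMeasure (sel n h)
  meas : ∀ n, Measurable (sel n)

instance [Nonempty X] : Nonempty (RegAlg X Y) :=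
  ⟨⟨fun _ _ => Measure.dirac (Classical.arbitrary X),
    fun _ _ => by infer_instance, fun _ => measurable_const⟩⟩

/-- Expected cumulative regret of algorithm `A` under model `M` over `T` rounds. -/
def expRegret (M : Model X Y) (A : RegAlg X Y) (T : ℕ) : ℝ :=
  ∑ t ∈ Finset.range T, ∫ h, (∫ x, gap M x ∂(A.sel t h)) ∂(histLaw M A.sel t)

/-- A PAC algorithm with `T` rounds of interaction: exploration kernels together with an
output kernel. -/
structure PacAlg (X Y : Type) [MeasurableSpace X] [MeasurableSpace Y] (T : ℕ) where
  explore : (n : ℕ) → Hist X Y n → Measure X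
  explore_prob : ∀ n h, IsProbabilityMeasure (explore n h)
  explore_meas : ∀ n, Measurable (explore n)
  out : Hist X Y T → Measure X
  out_prob : ∀ h, IsProbabilityMeasure (out h)
  out_meas : Measurable out

/-- Risk of the PAC algorithm conditionally on the realized history. -/
def condRisk (M : Model X Y) {T : ℕ} (A : PacAlg X Y T) (h : Hist X Y T) : ℝ :=
  ∫ x, gap M x ∂(A.out h)

/-- Expected risk of PAC algorithm `A` under model `M`. -/
def pacRisk (M : Model X Y) {T : ℕ} (A : PacAlg X Y T) : ℝ :=
  ∫ h, condRisk M A h ∂(histLaw M A.explore T)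

/-- The density-ratio bound `V(𝓜)`. -/
def Vval (𝓜 : Set (Model X Y)) : ℝ≥0∞ :=
  max (ENNReal.ofReal (Real.exp 1))
    (⨆ M ∈ 𝓜, ⨆ M' ∈ 𝓜, ⨆ x : X,
      ⨆ A ∈ {A : Set (ℝ × Y) | MeasurableSet A}, M.k x A / M'.k x A)

/-- `C(T) = log (min (T, V(𝓜)))`. -/
def Cval (𝓜 : Set (Model X Y)) (T : ℕ) : ℝ :=
  Real.log ((min (T : ℝ≥0∞) (Vval 𝓜)).toReal)

/-- An online estimation oracle for the class `𝓜` with estimation-error bound `Est`. -/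
structure EstOracle (X Y : Type) [MeasurableSpace X] [MeasurableSpace Y]
    (𝓜 : Set (Model X Y)) (Est : ℝ → ℝ → ℝ) where
  est : (T' : ℕ) → (δ' : ℝ) → (n : ℕ) → Hist X Y n → Model X Y
  est_mem : ∀ T' δ' n h, est T' δ' n h ∈ convHull 𝓜
  guarantee : ∀ (T' : ℕ) (δ' : ℝ), 0 < δ' → ∀ Mstar ∈ 𝓜, ∀ A : RegAlg X Y,
    ((histLaw Mstar A.sel T')
      {h : Hist X Y T' |
        (∑ t : Fin T',
          ∫ x, sqHellinger (Mstar.k x)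
              ((est T' δ' (t : ℕ) (hPrefix h (t : ℕ) t.2.le)).k x)
            ∂(A.sel (t : ℕ) (hPrefix h (t : ℕ) t.2.le)))
          ≤ Est (T' : ℝ) δ'}).toReal ≥ 1 - δ'

/-- A constrained online estimation oracle for the class `𝓜`. -/
structure CEstOracle (X Y : Type) [MeasurableSpace X] [MeasurableSpace Y]
    (𝓜 : Set (Model X Y)) (Est : ℝ → ℝ → ℝ) where
  est : (𝓜' : Set (Model X Y)) → (T' : ℕ) → (δ' : ℝ) → (n : ℕ) → Hist X Y n → Model X Y
  est_mem : ∀ 𝓜', 𝓜' ⊆ 𝓜 → ∀ T' δ' n h, est 𝓜' T' δ' n h ∈ convHull 𝓜'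
  guarantee : ∀ 𝓜', 𝓜' ⊆ 𝓜 → ∀ (T' : ℕ) (δ' : ℝ), 0 < δ' → ∀ Mstar ∈ 𝓜',
    ∀ A : RegAlg X Y,
    ((histLaw Mstar A.sel T')
      {h : Hist X Y T' |
        (∑ t : Fin T',
          ∫ x, sqHellinger (Mstar.k x)
              ((est 𝓜' T' δ' (t : ℕ) (hPrefix h (t : ℕ) t.2.le)).k x)
            ∂(A.sel (t : ℕ) (hPrefix h (t : ℕ) t.2.le)))
          ≤ Est (T' : ℝ) δ'}).toReal ≥ 1 - δ'

/-- A packaged (decision space, observation space) pair. -/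
structure MSpace where
  (X : Type)
  (Y : Type)
  [iX : MeasurableSpace X]
  [iY : MeasurableSpace Y]
  [nX : Nonempty X]

attribute [instance] MSpace.iX MSpace.iY MSpace.nX

end

noncomputable section

section Interaction

variable {X Y : Type} [MeasurableSpace X] [MeasurableSpace Y]

instance Model.isMarkovKernel (M : Model X Y) : IsMarkovKernel M.k := M.markov

instance RegAlg.isProbabilityMeasure (A : RegAlg X Y) (n : ℕ) (h : Hist X Y n) :
    IsProbabilityMeasure (A.sel n h) := A.prob n h

lemma ae_reward_mem (M : Model X Y) (x : X) :
    ∀ᵐ ry ∂(M.k x), ry.1 ∈ Set.Icc (0 : ℝ) 1 := M.reward01 x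

lemma integrable_of_bounded {Z : Type*} [MeasurableSpace Z] {μ : Measure Z} [IsFiniteMeasure μ]
    {f : Z → ℝ} (hf : Measurable f) {C : ℝ} (h0 : ∀ᵐ z ∂μ, 0 ≤ f z) (hC : ∀ᵐ z ∂μ, f z ≤ C) :
    Integrable f μ := by
  refine Integrable.of_bound hf.aestronglyMeasurable C ?_
  filter_upwards [h0, hC] with z h0 hC
  rwa [Real.norm_of_nonneg h0]

lemma integral_mem_Icc {Z : Type*} [MeasurableSpace Z] {μ : Measure Z} [IsProbabilityMeasure μ]
    {f : Z → ℝ} {C : ℝ} (h0 : ∀ᵐ z ∂μ, 0 ≤ f z) (hC : ∀ᵐ z ∂μ, f z ≤ C) :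
    ∫ z, f z ∂μ ∈ Set.Icc 0 C := by
  refine ⟨integral_nonneg_of_ae h0, ?_⟩
  calc ∫ z, f z ∂μ ≤ ∫ _, C ∂μ := integral_mono_of_nonneg h0 (integrable_const _) hC
    _ = C := by simp

lemma fm_mem_Icc (M : Model X Y) (x : X) : fm M x ∈ Set.Icc (0 : ℝ) 1 :=
  integral_mem_Icc ((ae_reward_mem M x).mono fun _ h => h.1)
    ((ae_reward_mem M x).mono fun _ h => h.2)

@[fun_prop]
lemma measurable_fm (M : Model X Y) : Measurable (fm M) :=
  (StronglyMeasurable.integral_kernel (κ := M.k) (f := fun ry : ℝ × Y => ry.1)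
    measurable_fst.stronglyMeasurable).measurable

@[fun_prop]
lemma measurable_gap (M : Model X Y) : Measurable (gap M) :=
  measurable_const.sub (measurable_fm M)

lemma gap_nonneg (M : Model X Y) (x : X) : 0 ≤ gap M x := sub_nonneg.2 (M.opt_max x)

lemma gap_le_one (M : Model X Y) (x : X) : gap M x ≤ 1 := by
  have h1 := (fm_mem_Icc M M.opt).2
  have h2 := (fm_mem_Icc M x).1
  unfold gap; linarith

lemma integrable_gap (M : Model X Y) (μ : Measure X) [IsProbabilityMeasure μ] :
    Integrable (gap M) μ :=
  integrable_of_bounded (measurable_gap M) (C := 1) (ae_of_all _ (gap_nonneg M))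
    (ae_of_all _ (gap_le_one M))

lemma ae_step_reward_mem (M : Model X Y) (μ : Measure X) [IsProbabilityMeasure μ] :
    ∀ᵐ z ∂(μ ⊗ₘ M.k), z.2.1 ∈ Set.Icc (0 : ℝ) 1 := by
  refine Measure.ae_compProd_of_ae_ae ?_ (ae_of_all _ fun x => ae_reward_mem M x)
  exact measurableSet_Icc.preimage (by fun_prop)

lemma integrable_step_reward (M : Model X Y) (μ : Measure X) [IsProbabilityMeasure μ] :
    Integrable (fun z : X × ℝ × Y => z.2.1) (μ ⊗ₘ M.k) :=
  integrable_of_bounded (by fun_prop) ((ae_step_reward_mem M μ).mono fun _ h => h.1)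
    ((ae_step_reward_mem M μ).mono fun _ h => h.2)

lemma integrable_step_gap (M : Model X Y) (μ : Measure X) [IsProbabilityMeasure μ] :
    Integrable (fun z : X × ℝ × Y => gap M z.1) (μ ⊗ₘ M.k) :=
  integrable_of_bounded (by fun_prop) (C := 1) (ae_of_all _ fun z => gap_nonneg M z.1)
    (ae_of_all _ fun z => gap_le_one M z.1)

lemma integral_step_gap (M : Model X Y) (μ : Measure X) [IsProbabilityMeasure μ] :
    ∫ z, gap M z.1 ∂(μ ⊗ₘ M.k) = ∫ x, gap M x ∂μ := by
  rw [Measure.integral_compProd (integrable_step_gap M μ)]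
  simp

lemma integral_step_reward (M : Model X Y) (μ : Measure X) [IsProbabilityMeasure μ] :
    ∫ z, z.2.1 ∂(μ ⊗ₘ M.k) = fm M M.opt - ∫ x, gap M x ∂μ := by
  rw [Measure.integral_compProd (integrable_step_reward M μ)]
  have h : ∀ x, ∫ ry, ry.1 ∂(M.k x) = fm M M.opt - gap M x := fun x => by
    simp [gap, fm]
  simp_rw [h]
  rw [integral_sub (integrable_const _) (integrable_gap M μ)]
  simp

/-- Append one round to a history. -/
def histSnoc {n : ℕ} (h : Hist X Y n) (z : X × ℝ × Y) : Hist X Y (n + 1) :=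
  Fin.snoc (α := fun _ => X × ℝ × Y) h z

lemma measurable_histSnoc {n : ℕ} :
    Measurable fun p : Hist X Y n × (X × ℝ × Y) => histSnoc p.1 p.2 := by
  refine measurable_pi_iff.2 fun i => ?_
  induction i using Fin.lastCases with
  | last => simpa [histSnoc] using measurable_snd
  | cast i =>
    simp only [histSnoc, Fin.snoc_castSucc]
    exact (measurable_pi_apply i).comp measurable_fst

/-- The expected regret incurred by `A` under `M` in the next `f` rounds, starting from a given
history of length `n`. -/
def futureRegret (M : Model X Y) (A : RegAlg X Y) : ℕ → (n : ℕ) → Hist X Y n → ℝ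
  | 0, _, _ => 0
  | f + 1, n, h =>
    ∫ z, (gap M z.1 + futureRegret M A f (n + 1) (histSnoc h z)) ∂(A.sel n h ⊗ₘ M.k)

/-- The joint law of decision, reward and observation in the next round. -/
def stepKernel (M : Model X Y) (A : RegAlg X Y) (n : ℕ) : Kernel (Hist X Y n) (X × ℝ × Y) :=
  (⟨A.sel n, A.meas n⟩ : Kernel (Hist X Y n) X) ⊗ₖ (M.k.prodMkLeft (Hist X Y n))

instance RegAlg.isMarkovKernel_sel (A : RegAlg X Y) (n : ℕ) :
    IsMarkovKernel (⟨A.sel n, A.meas n⟩ : Kernel (Hist X Y n) X) := ⟨A.prob n⟩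

instance isMarkovKernel_stepKernel (M : Model X Y) (A : RegAlg X Y) (n : ℕ) :
    IsMarkovKernel (stepKernel M A n) := by
  unfold stepKernel; infer_instance

lemma stepKernel_apply (M : Model X Y) (A : RegAlg X Y) (n : ℕ) (h : Hist X Y n) :
    stepKernel M A n h = A.sel n h ⊗ₘ M.k := by
  rw [stepKernel, Kernel.compProd_apply_eq_compProd_sectR]
  simp

lemma futureRegret_mem_Icc (M : Model X Y) (A : RegAlg X Y) (f n : ℕ) (h : Hist X Y n) :
    futureRegret M A f n h ∈ Set.Icc (0 : ℝ) f := by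
  induction f generalizing n with
  | zero => simp [futureRegret]
  | succ f ih =>
    refine integral_mem_Icc (ae_of_all _ fun z => ?_) (ae_of_all _ fun z => ?_)
    · exact add_nonneg (gap_nonneg M _) (ih _ _).1
    · have h1 := gap_le_one M z.1
      have h2 := (ih _ (histSnoc h z)).2
      push_cast; linarith

lemma measurable_futureRegret (M : Model X Y) (A : RegAlg X Y) (f n : ℕ) :
    Measurable (futureRegret M A f n) := by
  induction f generalizing n with
  | zero => exact measurable_const
  | succ f ih =>
    have h1 : Measurable fun p : Hist X Y n × (X × ℝ × Y) =>
        gap M p.2.1 + futureRegret M A f (n + 1) (histSnoc p.1 p.2) :=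
      Measurable.add (by fun_prop) ((ih (n + 1)).comp measurable_histSnoc)
    have h2 : futureRegret M A (f + 1) n = fun h => ∫ z, (gap M z.1 +
        futureRegret M A f (n + 1) (histSnoc h z)) ∂(stepKernel M A n h) := by
      funext h
      simp [futureRegret, stepKernel_apply]
    rw [h2]
    exact (h1.stronglyMeasurable.integral_kernel_prod_right' (κ := stepKernel M A n)).measurable

lemma integrable_futureRegret_histSnoc (M : Model X Y) (A : RegAlg X Y) (f n : ℕ)
    (h : Hist X Y n) (μ : Measure (X × ℝ × Y)) [IsFiniteMeasure μ] :
    Integrable (fun z => futureRegret M A f (n + 1) (histSnoc h z)) μ :=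
  integrable_of_bounded
    ((measurable_futureRegret M A f (n + 1)).comp
      (measurable_histSnoc.comp (measurable_const.prodMk measurable_id)))
    (ae_of_all _ fun _ => (futureRegret_mem_Icc M A f _ _).1)
    (ae_of_all _ fun _ => (futureRegret_mem_Icc M A f _ _).2)

lemma futureRegret_succ (M : Model X Y) (A : RegAlg X Y) (f n : ℕ) (h : Hist X Y n) :
    futureRegret M A (f + 1) n h = ∫ x, gap M x ∂(A.sel n h) +
      ∫ z, futureRegret M A f (n + 1) (histSnoc h z) ∂(A.sel n h ⊗ₘ M.k) := by
  rw [futureRegret, integral_add (integrable_step_gap M _)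
    (integrable_futureRegret_histSnoc M A f n h _), integral_step_gap]

lemma histLaw_succ (M : Model X Y) (A : RegAlg X Y) (n : ℕ) [SFinite (histLaw M A.sel n)] :
    histLaw M A.sel (n + 1) =
      (histLaw M A.sel n ⊗ₘ stepKernel M A n).map fun p => histSnoc p.1 p.2 := by
  ext s hs
  rw [Measure.map_apply measurable_histSnoc hs,
    Measure.compProd_apply (measurable_histSnoc hs)]
  have hm (h : Hist X Y n) : Measurable (histSnoc h) :=
    measurable_histSnoc.comp (measurable_const.prodMk measurable_id)
  have hmap : ∀ (h : Hist X Y n) (x : X) (t : Set (Hist X Y (n + 1))), MeasurableSet t →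
      ((M.k x).map fun ry => histSnoc h (x, ry)) t =
        M.k x (Prod.mk x ⁻¹' (histSnoc h ⁻¹' t)) := fun h x t ht =>
    Measure.map_apply ((hm h).comp measurable_prodMk_left) ht
  have h1 : ∀ (h : Hist X Y n) (x : X),
      ((M.k x).bind fun ry => Measure.dirac (Fin.snoc (α := fun _ => X × ℝ × Y) h (x, ry)))
        = (M.k x).map fun ry => histSnoc h (x, ry) := fun h x =>
    Measure.bind_dirac_eq_map _ ((hm h).comp measurable_prodMk_left)
  have h2 : ∀ h : Hist X Y n, ((A.sel n h).bind fun x =>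
      (M.k x).map fun ry => histSnoc h (x, ry)) = (stepKernel M A n h).map (histSnoc h) := by
    intro h
    have hmeas : Measurable fun x => (M.k x).map fun ry => histSnoc h (x, ry) := by
      refine Measure.measurable_of_measurable_coe _ fun t ht => ?_
      simp_rw [hmap h _ t ht]
      exact Kernel.measurable_kernel_prodMk_left ((hm h) ht)
    ext t ht
    rw [Measure.bind_apply ht hmeas.aemeasurable, Measure.map_apply (hm h) ht, stepKernel_apply,
      Measure.compProd_apply (hm h ht)]
    exact lintegral_congr fun x => hmap h x t ht
  have h3 : histLaw M A.sel (n + 1) = (histLaw M A.sel n).bind fun h =>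
      (stepKernel M A n h).map (histSnoc h) := by
    rw [histLaw]
    congr 1
    funext h
    rw [← h2]
    congr 1
    funext x
    exact h1 h x
  have h4 : ∀ (t : Set (Hist X Y (n + 1))) (ht : MeasurableSet t) (h : Hist X Y n),
      (stepKernel M A n h).map (histSnoc h) t = stepKernel M A n h
        (Prod.mk h ⁻¹' ((fun p : Hist X Y n × (X × ℝ × Y) => histSnoc p.1 p.2) ⁻¹' t)) := by
    intro t ht h
    rw [Measure.map_apply (hm h) ht]
    rfl
  have h5 : Measurable fun h : Hist X Y n => (stepKernel M A n h).map (histSnoc h) := by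
    refine Measure.measurable_of_measurable_coe _ fun t ht => ?_
    simp_rw [h4 t ht]
    exact Kernel.measurable_kernel_prodMk_left (measurable_histSnoc ht)
  rw [h3, Measure.bind_apply hs h5.aemeasurable]
  exact lintegral_congr fun h => h4 s hs h

instance isProbabilityMeasure_histLaw (M : Model X Y) (A : RegAlg X Y) (n : ℕ) :
    IsProbabilityMeasure (histLaw M A.sel n) := by
  induction n with
  | zero => rw [histLaw]; infer_instance
  | succ n ih =>
    rw [histLaw_succ]
    exact Measure.isProbabilityMeasure_map measurable_histSnoc.aemeasurable

lemma integral_futureRegret (M : Model X Y) (A : RegAlg X Y) (f n : ℕ) :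
    ∫ h, futureRegret M A f n h ∂(histLaw M A.sel n) =
      ∑ t ∈ Finset.range f,
        ∫ h, (∫ x, gap M x ∂(A.sel (n + t) h)) ∂(histLaw M A.sel (n + t)) := by
  induction f generalizing n with
  | zero => simp [futureRegret]
  | succ f ih =>
    have hF : Measurable fun p : Hist X Y n × (X × ℝ × Y) =>
        futureRegret M A f (n + 1) (histSnoc p.1 p.2) :=
      (measurable_futureRegret M A f (n + 1)).comp measurable_histSnoc
    have hFi : Integrable (fun p : Hist X Y n × (X × ℝ × Y) =>
        futureRegret M A f (n + 1) (histSnoc p.1 p.2)) (histLaw M A.sel n ⊗ₘ stepKernel M A n) :=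
      integrable_of_bounded hF (ae_of_all _ fun _ => (futureRegret_mem_Icc M A f _ _).1)
        (ae_of_all _ fun _ => (futureRegret_mem_Icc M A f _ _).2)
    have hg : Measurable fun h : Hist X Y n => ∫ x, gap M x ∂(A.sel n h) :=
      (StronglyMeasurable.integral_kernel
        (κ := (⟨A.sel n, A.meas n⟩ : Kernel (Hist X Y n) X))
        (measurable_gap M).stronglyMeasurable).measurable
    have hgi : Integrable (fun h : Hist X Y n => ∫ x, gap M x ∂(A.sel n h))
        (histLaw M A.sel n) :=
      integrable_of_bounded hg (C := 1)
        (ae_of_all _ fun h => integral_nonneg fun x => gap_nonneg M x)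
        (ae_of_all _ fun h => (integral_mem_Icc (ae_of_all _ (gap_nonneg M))
          (ae_of_all _ (gap_le_one M))).2)
    have hFk : Integrable (fun h : Hist X Y n =>
        ∫ z, futureRegret M A f (n + 1) (histSnoc h z) ∂(stepKernel M A n h))
        (histLaw M A.sel n) := hFi.integral_compProd
    simp_rw [futureRegret_succ]
    rw [Finset.sum_range_succ']
    simp_rw [← stepKernel_apply]
    rw [integral_add hgi hFk]
    have h1 : ∫ h, futureRegret M A f (n + 1) h ∂(histLaw M A.sel (n + 1)) =
        ∫ h, ∫ z, futureRegret M A f (n + 1) (histSnoc h z) ∂(stepKernel M A n h)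
          ∂(histLaw M A.sel n) := by
      rw [histLaw_succ, integral_map measurable_histSnoc.aemeasurable
        (measurable_futureRegret M A f (n + 1)).aestronglyMeasurable,
        Measure.integral_compProd hFi]
    rw [← h1, ih (n + 1), add_comm]
    congr 1
    refine Finset.sum_congr rfl fun t _ => ?_
    rw [show n + 1 + t = n + (t + 1) by ring]

lemma expRegret_eq_futureRegret (M : Model X Y) (A : RegAlg X Y) (T : ℕ) (h : Hist X Y 0) :
    expRegret M A T = futureRegret M A T 0 h := by
  have h1 := integral_futureRegret M A T 0
  rw [histLaw, integral_dirac' _ _ (measurable_futureRegret M A T 0).stronglyMeasurable] at h1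
  rw [Subsingleton.elim h fun i => i.elim0, h1, expRegret]
  exact Finset.sum_congr rfl fun t _ => by rw [Nat.zero_add]

end Interaction

section Switching

variable {X Y : Type} [MeasurableSpace X] [MeasurableSpace Y]

/-- A regret algorithm driven by a state process: decisions are drawn from a law depending on the
current state, which is updated after each round. -/
structure StateAlg (X Y S : Type) [MeasurableSpace X] [MeasurableSpace Y] [MeasurableSpace S] where
  init : S
  policy : S → Measure X
  prob : ∀ s, IsProbabilityMeasure (policy s)
  measurable_policy : Measurable policy
  update : S → X × ℝ × Y → S
  measurable_update : Measurable fun p : S × (X × ℝ × Y) => update p.1 p.2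

namespace StateAlg

variable {S : Type} [MeasurableSpace S]

instance (B : StateAlg X Y S) (s : S) : IsProbabilityMeasure (B.policy s) := B.prob s

/-- The state reached after a given history. -/
def state (B : StateAlg X Y S) : (n : ℕ) → Hist X Y n → S
  | 0, _ => B.init
  | n + 1, h => B.update (B.state n fun i => h i.castSucc) (h (Fin.last n))

lemma measurable_state (B : StateAlg X Y S) (n : ℕ) : Measurable (B.state n) := by
  induction n with
  | zero => exact measurable_const
  | succ n ih =>
    refine B.measurable_update.comp (Measurable.prodMk (ih.comp ?_) (measurable_pi_apply _))
    exact measurable_pi_iff.2 fun i => measurable_pi_apply _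

lemma state_histSnoc (B : StateAlg X Y S) {n : ℕ} (h : Hist X Y n) (z : X × ℝ × Y) :
    B.state (n + 1) (histSnoc h z) = B.update (B.state n h) z := by
  simp [state, histSnoc]

/-- The regret algorithm implemented by a state process. -/
def toRegAlg (B : StateAlg X Y S) : RegAlg X Y where
  sel n h := B.policy (B.state n h)
  prob _ _ := B.prob _
  meas n := B.measurable_policy.comp (B.measurable_state n)

lemma futureRegret_le_potential (B : StateAlg X Y S) (M : Model X Y) (T : ℕ)
    (V : ℕ → S → ℝ) (Inv : ℕ → S → Prop)
    (hInv : ∀ t s z, Inv t s → Inv (t + 1) (B.update s z))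
    (hV : ∀ s, Inv T s → 0 ≤ V T s)
    (hstep : ∀ t < T, ∀ s, Inv t s → ∃ g : X × ℝ × Y → ℝ,
      Integrable g (B.policy s ⊗ₘ M.k) ∧
      (∀ z, z.2.1 ∈ Set.Icc (0 : ℝ) 1 → V (t + 1) (B.update s z) ≤ g z) ∧
      ∫ x, gap M x ∂(B.policy s) + ∫ z, g z ∂(B.policy s ⊗ₘ M.k) ≤ V t s)
    (f t : ℕ) (hft : t + f = T) (h : Hist X Y t) (hs : Inv t (B.state t h)) :
    futureRegret M B.toRegAlg f t h ≤ V t (B.state t h) := by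
  induction f generalizing t with
  | zero =>
    obtain rfl : t = T := by omega
    exact hV _ hs
  | succ f ih =>
    obtain ⟨g, hg, hle, hsum⟩ := hstep t (by omega) _ hs
    rw [futureRegret_succ]
    refine le_trans ?_ hsum
    refine add_le_add le_rfl ?_
    refine integral_mono_of_nonneg (ae_of_all _ fun z => (futureRegret_mem_Icc _ _ _ _ _).1) hg ?_
    filter_upwards [ae_step_reward_mem M (B.policy (B.state t h))] with z hz
    refine le_trans (ih (t + 1) (by omega) (histSnoc h z) ?_) ?_
    · rw [state_histSnoc]; exact hInv _ _ _ hs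
    · rw [state_histSnoc]; exact hle z hz

lemma expRegret_le_potential (B : StateAlg X Y S) (M : Model X Y) (T : ℕ)
    (V : ℕ → S → ℝ) (Inv : ℕ → S → Prop)
    (hInit : Inv 0 B.init)
    (hInv : ∀ t s z, Inv t s → Inv (t + 1) (B.update s z))
    (hV : ∀ s, Inv T s → 0 ≤ V T s)
    (hstep : ∀ t < T, ∀ s, Inv t s → ∃ g : X × ℝ × Y → ℝ,
      Integrable g (B.policy s ⊗ₘ M.k) ∧
      (∀ z, z.2.1 ∈ Set.Icc (0 : ℝ) 1 → V (t + 1) (B.update s z) ≤ g z) ∧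
      ∫ x, gap M x ∂(B.policy s) + ∫ z, g z ∂(B.policy s ⊗ₘ M.k) ≤ V t s) :
    expRegret M B.toRegAlg T ≤ V 0 B.init := by
  rw [expRegret_eq_futureRegret M _ T fun i => i.elim0]
  exact B.futureRegret_le_potential M T V Inv hInv hV hstep T 0 (by omega) _ hInit

end StateAlg

lemma exists_affine_majorant (M : Model X Y) (A : RegAlg X Y) (f n : ℕ) (h : Hist X Y n)
    {a b c W : ℝ} {V : X × ℝ × Y → ℝ}
    (hV : ∀ z : X × ℝ × Y, z.2.1 ∈ Set.Icc (0 : ℝ) 1 →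
      V z ≤ a + b * (z.2.1 - fm M M.opt) + c * futureRegret M A f (n + 1) (histSnoc h z))
    (hW : ∀ d : ℝ, 0 ≤ d → d + (a - b * d + c * (futureRegret M A (f + 1) n h - d)) ≤ W) :
    ∃ g : X × ℝ × Y → ℝ, Integrable g (A.sel n h ⊗ₘ M.k) ∧
      (∀ z, z.2.1 ∈ Set.Icc (0 : ℝ) 1 → V z ≤ g z) ∧
      ∫ x, gap M x ∂(A.sel n h) + ∫ z, g z ∂(A.sel n h ⊗ₘ M.k) ≤ W := by
  have hr := integrable_step_reward M (A.sel n h)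
  have hF := integrable_futureRegret_histSnoc M A f n h (A.sel n h ⊗ₘ M.k)
  have h1 : Integrable (fun z : X × ℝ × Y => b * (z.2.1 - fm M M.opt)) (A.sel n h ⊗ₘ M.k) :=
    (hr.sub (integrable_const _)).const_mul b
  have h2 : Integrable (fun z : X × ℝ × Y => a + b * (z.2.1 - fm M M.opt))
      (A.sel n h ⊗ₘ M.k) := (integrable_const a).add h1
  refine ⟨_, h2.add (hF.const_mul c), hV, ?_⟩
  have h3 := hW (∫ x, gap M x ∂(A.sel n h)) (integral_nonneg (gap_nonneg M))
  have h4 : ∫ z, ((fun z : X × ℝ × Y => a + b * (z.2.1 - fm M M.opt)) +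
      fun z => c * futureRegret M A f (n + 1) (histSnoc h z)) z ∂(A.sel n h ⊗ₘ M.k) =
      a - b * (∫ x, gap M x ∂(A.sel n h)) +
        c * (futureRegret M A (f + 1) n h - ∫ x, gap M x ∂(A.sel n h)) := by
    rw [integral_add' h2 (hF.const_mul c), integral_add (integrable_const a) h1,
      integral_const_mul, integral_const_mul, integral_sub hr (integrable_const _),
      integral_step_reward, futureRegret_succ]
    simp
    ring
  rw [h4]
  exact h3

lemma exists_affine_majorant_dirac (M : Model X Y) (x₀ : X)
    {a b W : ℝ} {V : X × ℝ × Y → ℝ}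
    (hV : ∀ z : X × ℝ × Y, z.2.1 ∈ Set.Icc (0 : ℝ) 1 → V z ≤ a + b * (z.2.1 - fm M M.opt))
    (hW : gap M x₀ + (a - b * gap M x₀) ≤ W) :
    ∃ g : X × ℝ × Y → ℝ, Integrable g (Measure.dirac x₀ ⊗ₘ M.k) ∧
      (∀ z, z.2.1 ∈ Set.Icc (0 : ℝ) 1 → V z ≤ g z) ∧
      ∫ x, gap M x ∂(Measure.dirac x₀) + ∫ z, g z ∂(Measure.dirac x₀ ⊗ₘ M.k) ≤ W := by
  have hr := integrable_step_reward M (Measure.dirac x₀)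
  have h1 : Integrable (fun z : X × ℝ × Y => b * (z.2.1 - fm M M.opt))
      (Measure.dirac x₀ ⊗ₘ M.k) := (hr.sub (integrable_const _)).const_mul b
  refine ⟨_, (integrable_const a).add h1, hV, ?_⟩
  have h2 : ∫ x, gap M x ∂(Measure.dirac x₀) = gap M x₀ :=
    integral_dirac' _ _ (measurable_gap M).stronglyMeasurable
  have h4 : ∫ z, ((fun _ : X × ℝ × Y => a) +
      fun z : X × ℝ × Y => b * (z.2.1 - fm M M.opt)) z ∂(Measure.dirac x₀ ⊗ₘ M.k) =
      a - b * gap M x₀ := by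
    rw [integral_add' (integrable_const a) h1, integral_const_mul,
      integral_sub hr (integrable_const _), integral_step_reward, h2]
    simp
    ring
  rw [h2, h4]
  exact hW

/-- The state of the level-switching algorithm: the level, the number of remaining reference
rounds, the number of rounds played by the current run of the base algorithm, the score of that
run, and a buffer holding its history. -/
abbrev SwitchState (X Y : Type) := (ℕ × ℕ × ℕ) × (ℝ × (ℕ → X × ℝ × Y))

/-- Parameters of the level-switching algorithm. At level `0` only the base algorithm is played,
at a level `1 ≤ j ≤ top` each round of the base algorithm is followed by `4 ^ j` rounds of the
reference decision, and beyond level `top` only the reference decision is played. A run at level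
`j` ends when its score leaves the interval `(-lo j, hi j)`. -/
structure SwitchParams (X Y : Type) [MeasurableSpace X] [MeasurableSpace Y] where
  alg : RegAlg X Y
  ref : X
  top : ℕ
  lo : ℕ → ℝ
  hi : ℕ → ℝ
  base : ℝ

namespace SwitchParams

/-- Move to an adjacent level, with a fresh run, when the score is out of range. -/
def settle (P : SwitchParams X Y) (j k n : ℕ) (w : ℝ) (h : ℕ → X × ℝ × Y) : SwitchState X Y :=
  if w ≤ -P.lo j then ((j + 1, 0, 0), (0, h))
  else if 0 < j ∧ P.hi j ≤ w then ((j - 1, 0, 0), (0, h))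
  else ((j, k, n), (w, h))

/-- The reward clamped to `[0,1]`. -/
def clamp (r : ℝ) : ℝ := max 0 (min 1 r)

lemma clamp_of_mem {r : ℝ} (hr : r ∈ Set.Icc (0 : ℝ) 1) : clamp r = r := by
  simp [clamp, hr.1, hr.2]

/-- State update of the level-switching algorithm. -/
def update (P : SwitchParams X Y) (s : SwitchState X Y) (z : X × ℝ × Y) : SwitchState X Y :=
  if P.top < s.1.1 then s
  else if 0 < s.1.2.1 then
    P.settle s.1.1 (s.1.2.1 - 1) s.1.2.2 (s.2.1 - clamp z.2.1 / 4 ^ s.1.1) s.2.2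
  else P.settle s.1.1 (if s.1.1 = 0 then 0 else 4 ^ s.1.1) (s.1.2.2 + 1)
    (s.2.1 + clamp z.2.1 - if s.1.1 = 0 then P.base else 0)
    (Function.update s.2.2 s.1.2.2 z)

/-- Decision law of the level-switching algorithm. -/
def policy (P : SwitchParams X Y) (s : SwitchState X Y) : Measure X :=
  if P.top < s.1.1 ∨ 0 < s.1.2.1 then Measure.dirac P.ref
  else P.alg.sel s.1.2.2 fun i => s.2.2 i

lemma measurable_settle (P : SwitchParams X Y) (j k n : ℕ) :
    Measurable fun p : ℝ × (ℕ → X × ℝ × Y) => P.settle j k n p.1 p.2 := by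
  unfold settle
  refine Measurable.ite (measurableSet_le measurable_fst measurable_const) (by fun_prop) ?_
  refine Measurable.ite ?_ (by fun_prop) (by fun_prop)
  by_cases hj : 0 < j
  · simpa [hj] using measurableSet_le measurable_const measurable_fst
  · simp [hj]

lemma measurable_update (P : SwitchParams X Y) :
    Measurable fun p : SwitchState X Y × (X × ℝ × Y) => P.update p.1 p.2 := by
  have h1 : Measurable fun q : (ℕ × ℕ × ℕ) × ((ℝ × (ℕ → X × ℝ × Y)) × (X × ℝ × Y)) =>
      P.update (q.1, q.2.1) q.2.2 := by
    refine measurable_from_prod_countable_right fun d => ?_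
    obtain ⟨j, k, n⟩ := d
    have hc : Measurable clamp := by unfold clamp; fun_prop
    have hb : Measurable fun a : (ℝ × (ℕ → X × ℝ × Y)) × (X × ℝ × Y) =>
        Function.update a.1.2 n a.2 := by
      refine measurable_pi_iff.2 fun i => ?_
      by_cases hi : i = n
      · subst hi; simpa using measurable_snd
      · simp only [Function.update_of_ne hi]; fun_prop
    simp only [update]
    by_cases hj : P.top < j
    · simp only [hj, if_true]; fun_prop
    by_cases hk : 0 < k
    · simp only [hj, hk, if_true, if_false]
      exact (P.measurable_settle j (k - 1) n).comp
        (Measurable.prodMk (by fun_prop) (by fun_prop))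
    · simp only [hj, hk, if_false]
      exact (P.measurable_settle j _ (n + 1)).comp (Measurable.prodMk (by split_ifs <;> fun_prop) hb)
  exact h1.comp (by fun_prop :
    Measurable fun p : SwitchState X Y × (X × ℝ × Y) => (p.1.1, (p.1.2, p.2)))

lemma measurable_policy (P : SwitchParams X Y) : Measurable P.policy := by
  refine measurable_from_prod_countable_right fun d => ?_
  obtain ⟨j, k, n⟩ := d
  simp only [policy]
  by_cases hj : P.top < j ∨ 0 < k
  · simp only [hj, if_true]; exact measurable_const
  · simp only [hj, if_false]
    refine (P.alg.meas n).comp ?_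
    exact measurable_pi_iff.2 fun i => (measurable_pi_apply _).comp measurable_snd

/-- The level-switching algorithm, with buffer initialized to `h₀`. -/
def toStateAlg (P : SwitchParams X Y) (h₀ : ℕ → X × ℝ × Y) :
    StateAlg X Y (SwitchState X Y) where
  init := ((0, 0, 0), (0, h₀))
  policy := P.policy
  prob s := by
    unfold policy
    split_ifs <;> infer_instance
  measurable_policy := P.measurable_policy
  update := P.update
  measurable_update := P.measurable_update

/-- The range of states reachable by the level-switching algorithm after `t` rounds. -/
def Valid (P : SwitchParams X Y) (t : ℕ) (s : SwitchState X Y) : Prop :=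
  s.1.1 ≤ P.top + 1 ∧ s.1.2.1 ≤ 4 ^ s.1.1 ∧ (s.1.1 = 0 → s.1.2.1 = 0) ∧ s.1.2.2 ≤ t ∧
    -P.lo s.1.1 ≤ s.2.1 ∧ (0 < s.1.1 → s.2.1 ≤ P.hi s.1.1)

lemma valid_settle (P : SwitchParams X Y) (hlo : ∀ j, 0 ≤ P.lo j) (hhi : ∀ j, 0 ≤ P.hi j)
    {t j k n : ℕ} {w : ℝ} {h : ℕ → X × ℝ × Y} (hj : j ≤ P.top) (hk : k ≤ 4 ^ j)
    (hj0 : j = 0 → k = 0) (hn : n ≤ t) : P.Valid t (P.settle j k n w h) := by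
  unfold settle
  split_ifs with h1 h2
  · exact ⟨by simpa using hj, by simp, by simp, by simp, by simpa using hlo _,
      by simpa using hhi _⟩
  · exact ⟨by simp only; omega, by simp, by simp, by simp, by simpa using hlo _,
      fun _ => by simpa using hhi _⟩
  · refine ⟨by simp only; omega, hk, hj0, hn, (not_le.1 h1).le, fun hj' => ?_⟩
    by_contra hw
    exact h2 ⟨hj', (not_le.1 hw).le⟩

lemma valid_update (P : SwitchParams X Y) (hlo : ∀ j, 0 ≤ P.lo j) (hhi : ∀ j, 0 ≤ P.hi j)
    {t : ℕ} {s : SwitchState X Y} (z : X × ℝ × Y) (hs : P.Valid t s) :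
    P.Valid (t + 1) (P.update s z) := by
  obtain ⟨h1, h2, h3, h4, h5, h6⟩ := hs
  unfold update
  split_ifs with hj hk hj0
  · exact ⟨h1, h2, h3, by omega, h5, h6⟩
  · exact P.valid_settle hlo hhi (by omega) (by omega) (by omega) (by omega)
  · exact P.valid_settle hlo hhi (by omega) (by omega) (by omega) (by omega)
  · exact P.valid_settle hlo hhi (by omega) le_rfl (fun h => absurd h hj0) (by omega)

lemma le_of_settle (P : SwitchParams X Y) {V : SwitchState X Y → ℝ} {j k n : ℕ} {w Q : ℝ}
    {h : ℕ → X × ℝ × Y}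
    (hdown : w ≤ -P.lo j → V ((j + 1, 0, 0), (0, h)) ≤ Q)
    (hup : 0 < j → P.hi j ≤ w → V ((j - 1, 0, 0), (0, h)) ≤ Q)
    (hstay : V ((j, k, n), (w, h)) ≤ Q) : V (P.settle j k n w h) ≤ Q := by
  unfold settle
  split_ifs with h1 h2
  · exact hdown h1
  · exact hup h2.1 h2.2
  · exact hstay

end SwitchParams

end Switching

section Potentials

lemma update_eq_histSnoc {X Y : Type} {n : ℕ} (h : ℕ → X × ℝ × Y) (z : X × ℝ × Y) :
    (fun i : Fin (n + 1) => Function.update h n z i) = histSnoc (fun i : Fin n => h i) z := by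
  funext i
  induction i using Fin.lastCases with
  | last => simp [histSnoc]
  | cast i =>
    have hi : (i : ℕ) ≠ n := i.2.ne
    simp [histSnoc, hi]

lemma sq_negPart_add_le (w x : ℝ) :
    (max 0 (-(w + x))) ^ 2 ≤ (max 0 (-w)) ^ 2 - 2 * max 0 (-w) * x + x ^ 2 := by
  rcases max_cases 0 (-(w + x)) with ⟨h1, h2⟩ | ⟨h1, h2⟩ <;>
    rcases max_cases 0 (-w) with ⟨h3, h4⟩ | ⟨h3, h4⟩ <;> rw [h1, h3] <;> nlinarith

lemma sq_posPart_add_le (w x : ℝ) :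
    (max 0 (w + x)) ^ 2 ≤ (max 0 w) ^ 2 + 2 * max 0 w * x + x ^ 2 := by
  have h := sq_negPart_add_le (-w) (-x)
  rw [show -(-w + -x) = w + x by ring, neg_neg] at h
  linarith [neg_sq x]

variable {X Y : Type} [MeasurableSpace X] [MeasurableSpace Y]

namespace SwitchParams

/-- Compatibility conditions between the thresholds of the level-switching algorithm and a bound
`v j` on the future regret of a run started at level `j`, when the base algorithm has regret
at most `R`. -/
structure ClassBudget (P : SwitchParams X Y) (T : ℕ) (R : ℝ) (v κ : ℕ → ℝ) : Prop where
  lo_nonneg : ∀ j, 0 ≤ P.lo j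
  hi_nonneg : ∀ j, 0 ≤ P.hi j
  v_nonneg : ∀ j, 0 ≤ v j
  κ_nonneg : ∀ j, 0 ≤ κ j
  exit_zero : v 1 ≤ κ 0 * P.lo 0 ^ 2
  exit_pos : ∀ j, 0 < j → j ≤ P.top → v (j + 1) ≤ v (j - 1) + κ j * P.lo j ^ 2
  start_zero : (1 + 2 * κ 0 * (P.lo 0 + 1)) * R + κ 0 * T ≤ v 0
  start_pos : ∀ j, 0 < j → j ≤ P.top →
    v (j - 1) + 4 ^ j * (P.hi j + 1) + (4 ^ j + 1 + 2 * κ j * (P.lo j + 1)) * R +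
      κ j * (2 * T / 4 ^ j + 1) ≤ v j
  start_top : T ≤ v (P.top + 1)

/-- Bound on the future regret of the level-switching algorithm at level `0`. -/
def zeroBound (P : SwitchParams X Y) (M : Model X Y) (T : ℕ) (κ : ℕ → ℝ)
    (t n : ℕ) (w : ℝ) (h : ℕ → X × ℝ × Y) : ℝ :=
  (1 + 2 * κ 0 * (P.lo 0 + 1)) * futureRegret M P.alg (T - n) n (fun i => h i) +
    κ 0 * ((max 0 (-w)) ^ 2 + (T - t))

/-- Bound on the future regret of the level-switching algorithm at an intermediate level. -/
def midBound (P : SwitchParams X Y) (M : Model X Y) (T : ℕ) (v κ : ℕ → ℝ)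
    (t j k n : ℕ) (w : ℝ) (h : ℕ → X × ℝ × Y) : ℝ :=
  v (j - 1) + 4 ^ j * (P.hi j + 1 - (w - fm M M.opt * k / 4 ^ j)) +
    (4 ^ j + 1 + 2 * κ j * (P.lo j + 1)) * futureRegret M P.alg (T - n) n (fun i => h i) +
    κ j * ((max 0 (-(w - fm M M.opt * k / 4 ^ j))) ^ 2 + 2 * (T - t) / 4 ^ j + 1 - k / 4 ^ j)

/-- Bound on the future regret of the level-switching algorithm under a model for which the base
algorithm has small regret. -/
def classBound (P : SwitchParams X Y) (M : Model X Y) (T : ℕ) (v κ : ℕ → ℝ)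
    (t : ℕ) (s : SwitchState X Y) : ℝ :=
  if P.top < s.1.1 then T - t
  else if s.1.1 = 0 then P.zeroBound M T κ t s.1.2.2 s.2.1 s.2.2
  else P.midBound M T v κ t s.1.1 s.1.2.1 s.1.2.2 s.2.1 s.2.2

namespace ClassBudget

variable {P : SwitchParams X Y} {M : Model X Y} {T : ℕ} {R : ℝ} {v κ : ℕ → ℝ}

lemma classBound_fresh (hB : P.ClassBudget T R v κ) (hR : expRegret M P.alg T ≤ R)
    (t j : ℕ) (hj : j ≤ P.top + 1) (h : ℕ → X × ℝ × Y) :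
    P.classBound M T v κ t ((j, 0, 0), (0, h)) ≤ v j := by
  have ht : (0 : ℝ) ≤ t := Nat.cast_nonneg t
  have hF : futureRegret M P.alg T 0 (fun i => h i) ≤ R := by
    rwa [← expRegret_eq_futureRegret]
  have hκ := hB.κ_nonneg j
  have hl := hB.lo_nonneg j
  unfold classBound
  split_ifs with h1 h2
  · obtain rfl : j = P.top + 1 := le_antisymm hj h1
    linarith [hB.start_top]
  · obtain rfl : j = 0 := h2
    have h3 := hB.start_zero
    have h4 := mul_le_mul_of_nonneg_left hF
      (by positivity : 0 ≤ 1 + 2 * κ 0 * (P.lo 0 + 1))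
    simp only [zeroBound, Nat.sub_zero]
    simp only [neg_zero, max_self]
    nlinarith
  · have h3 := hB.start_pos j (Nat.pos_of_ne_zero h2) (not_lt.1 h1)
    have h4 := mul_le_mul_of_nonneg_left hF
      (by positivity : 0 ≤ 4 ^ j + 1 + 2 * κ j * (P.lo j + 1))
    have h5 : κ j * (2 * (T - t) / 4 ^ j + 1) ≤ κ j * (2 * T / 4 ^ j + 1) := by
      gcongr; linarith
    simp only [midBound, Nat.sub_zero, Nat.cast_zero, mul_zero, zero_div, sub_zero, neg_zero,
      max_self]
    nlinarith

lemma classBound_settle_zero (hB : P.ClassBudget T R v κ) (hR : expRegret M P.alg T ≤ R)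
    {t n : ℕ} (ht : t ≤ T) (w : ℝ) (h : ℕ → X × ℝ × Y) :
    P.classBound M T v κ t (P.settle 0 0 n w h) ≤ P.zeroBound M T κ t n w h := by
  refine P.le_of_settle (V := P.classBound M T v κ t) (fun hw => ?_)
    (fun h0 => absurd h0 (lt_irrefl 0)) ?_
  · refine (hB.classBound_fresh hR t 1 (by omega) h).trans (hB.exit_zero.trans ?_)
    have hκ := hB.κ_nonneg 0
    have hl := hB.lo_nonneg 0
    have hF := (futureRegret_mem_Icc M P.alg (T - n) n (fun i => h i)).1
    have ht' : (t : ℝ) ≤ T := by exact_mod_cast ht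
    have hle : P.lo 0 ≤ max 0 (-w) := le_max_of_le_right (by linarith)
    have h1 : P.lo 0 ^ 2 ≤ (max 0 (-w)) ^ 2 + (T - t) := by nlinarith
    unfold zeroBound
    nlinarith [mul_le_mul_of_nonneg_left h1 hκ,
      mul_nonneg (by positivity : 0 ≤ 1 + 2 * κ 0 * (P.lo 0 + 1)) hF]
  · simp [classBound]

lemma classBound_settle_pos (hB : P.ClassBudget T R v κ) (hR : expRegret M P.alg T ≤ R)
    {t j k n : ℕ} (ht : t ≤ T) (hj0 : 0 < j) (hj : j ≤ P.top) (hk : k ≤ 4 ^ j) {w : ℝ}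
    (hw : w ≤ P.hi j + 1) (h : ℕ → X × ℝ × Y) :
    P.classBound M T v κ t (P.settle j k n w h) ≤ P.midBound M T v κ t j k n w h := by
  have hκ := hB.κ_nonneg j
  have hl := hB.lo_nonneg j
  have hf := (fm_mem_Icc M M.opt).1
  have hF := (futureRegret_mem_Icc M P.alg (T - n) n (fun i => h i)).1
  have ht' : (t : ℝ) ≤ T := by exact_mod_cast ht
  have hk' : (k : ℝ) / 4 ^ j ≤ 1 := by
    rw [div_le_one (by positivity)]; exact_mod_cast hk
  have hfk : 0 ≤ fm M M.opt * k / 4 ^ j := by positivity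
  have hs : 0 ≤ 2 * ((T : ℝ) - t) / 4 ^ j := by
    have := sub_nonneg.2 ht'; positivity
  have h2 := mul_nonneg (by positivity : 0 ≤ 4 ^ j + 1 + 2 * κ j * (P.lo j + 1)) hF
  have h3 : 0 ≤ 4 ^ j * (P.hi j + 1 - (w - fm M M.opt * k / 4 ^ j)) :=
    mul_nonneg (by positivity) (by linarith)
  refine P.le_of_settle (V := P.classBound M T v κ t) (fun hw' => ?_) (fun _ _ => ?_) ?_
  · refine (hB.classBound_fresh hR t (j + 1) (by omega) h).trans
      ((hB.exit_pos j hj0 hj).trans ?_)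
    have hle : P.lo j ≤ max 0 (-(w - fm M M.opt * k / 4 ^ j)) :=
      le_max_of_le_right (by linarith)
    have h1 : P.lo j ^ 2 ≤ (max 0 (-(w - fm M M.opt * k / 4 ^ j))) ^ 2 +
        2 * (T - t) / 4 ^ j + 1 - k / 4 ^ j := by nlinarith
    unfold midBound
    linarith [mul_le_mul_of_nonneg_left h1 hκ]
  · refine (hB.classBound_fresh hR t (j - 1) (by omega) h).trans ?_
    have h1 : 0 ≤ (max 0 (-(w - fm M M.opt * k / 4 ^ j))) ^ 2 +
        2 * (T - t) / 4 ^ j + 1 - k / 4 ^ j := by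
      nlinarith [sq_nonneg (max 0 (-(w - fm M M.opt * k / 4 ^ j)))]
    unfold midBound
    linarith [mul_nonneg hκ h1]
  · simp [classBound, not_lt.2 hj, hj0.ne']

lemma classBound_nonneg (hB : P.ClassBudget T R v κ) {s : SwitchState X Y}
    (hs : P.Valid T s) : 0 ≤ P.classBound M T v κ T s := by
  obtain ⟨⟨j, k, n⟩, w, h⟩ := s
  obtain ⟨-, hk, -, -, -, hw⟩ := hs
  simp only at hk hw
  have hκ := hB.κ_nonneg j
  have hl := hB.lo_nonneg j
  have hv := hB.v_nonneg (j - 1)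
  have hf := (fm_mem_Icc M M.opt).1
  have hF := (futureRegret_mem_Icc M P.alg (T - n) n (fun i => h i)).1
  unfold classBound
  split_ifs with h1 h2
  · simp
  · obtain rfl : j = 0 := h2
    simp only [zeroBound, sub_self]
    positivity
  · have hk' : (k : ℝ) / 4 ^ j ≤ 1 := by
      rw [div_le_one (by positivity)]; exact_mod_cast hk
    have hfk : 0 ≤ fm M M.opt * k / 4 ^ j := by positivity
    have h3 : 0 ≤ P.hi j + 1 - (w - fm M M.opt * k / 4 ^ j) := by
      linarith [hw (Nat.pos_of_ne_zero h2)]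
    have h4 : 0 ≤ (max 0 (-(w - fm M M.opt * k / 4 ^ j))) ^ 2 + 2 * (T - T) / 4 ^ j + 1 -
        k / 4 ^ j := by
      rw [sub_self, mul_zero, zero_div]
      linarith [sq_nonneg (max 0 (-(w - fm M M.opt * k / 4 ^ j)))]
    simp only [midBound]
    positivity

lemma classBound_step_zero (hB : P.ClassBudget T R v κ) (hR : expRegret M P.alg T ≤ R)
    (hb0 : 0 ≤ P.base) (hb : P.base ≤ fm M M.opt) {t n : ℕ} (ht : t < T) (hn : n ≤ t) {w : ℝ}
    (hw : -P.lo 0 ≤ w) (h : ℕ → X × ℝ × Y) :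
    ∃ g : X × ℝ × Y → ℝ, Integrable g (P.alg.sel n (fun i => h i) ⊗ₘ M.k) ∧
      (∀ z, z.2.1 ∈ Set.Icc (0 : ℝ) 1 →
        P.classBound M T v κ (t + 1)
          (P.settle 0 0 (n + 1) (w + z.2.1 - P.base) (Function.update h n z)) ≤ g z) ∧
      ∫ x, gap M x ∂(P.alg.sel n fun i => h i) +
        ∫ z, g z ∂(P.alg.sel n (fun i => h i) ⊗ₘ M.k) ≤ P.zeroBound M T κ t n w h := by
  have hκ := hB.κ_nonneg 0
  have hl := hB.lo_nonneg 0
  have hf := (fm_mem_Icc M M.opt).2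
  have hN : max 0 (-w) ≤ P.lo 0 := max_le hl (by linarith)
  have hN0 : 0 ≤ max 0 (-w) := le_max_left _ _
  obtain ⟨f, hf'⟩ : ∃ f, T - n = f + 1 := ⟨T - n - 1, by omega⟩
  have hf'' : T - (n + 1) = f := by omega
  refine exists_affine_majorant M P.alg f n (fun i => h i)
    (a := κ 0 * ((max 0 (-w)) ^ 2 + (T - t)))
    (b := -(2 * κ 0 * max 0 (-w))) (c := 1 + 2 * κ 0 * (P.lo 0 + 1)) (fun z hz => ?_)
    (fun d hd => ?_)
  · refine (hB.classBound_settle_zero hR ht _ _).trans ?_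
    simp only [zeroBound, hf'', update_eq_histSnoc]
    have h1 := sq_negPart_add_le w (z.2.1 - P.base)
    have h2 : (z.2.1 - P.base) ^ 2 ≤ 1 := by
      have := hz.1; have := hz.2
      nlinarith
    have h3 : (max 0 (-(w + z.2.1 - P.base))) ^ 2 + (T - ((t + 1 : ℕ) : ℝ)) ≤
        (max 0 (-w)) ^ 2 + (T - t) - 2 * max 0 (-w) * (z.2.1 - fm M M.opt) := by
      rw [add_sub_assoc]; push_cast
      nlinarith
    nlinarith [mul_le_mul_of_nonneg_left h3 hκ]
  · simp only [zeroBound, hf']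
    nlinarith [mul_nonneg (mul_nonneg hκ hd) (by linarith : 0 ≤ P.lo 0 + 1 - max 0 (-w))]

lemma classBound_step_base (hB : P.ClassBudget T R v κ) (hR : expRegret M P.alg T ≤ R)
    {t j n : ℕ} (ht : t < T) (hn : n ≤ t) (hj0 : 0 < j) (hj : j ≤ P.top) {w : ℝ}
    (hw : -P.lo j ≤ w) (hw' : w ≤ P.hi j) (h : ℕ → X × ℝ × Y) :
    ∃ g : X × ℝ × Y → ℝ, Integrable g (P.alg.sel n (fun i => h i) ⊗ₘ M.k) ∧
      (∀ z, z.2.1 ∈ Set.Icc (0 : ℝ) 1 →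
        P.classBound M T v κ (t + 1)
          (P.settle j (4 ^ j) (n + 1) (w + z.2.1) (Function.update h n z)) ≤ g z) ∧
      ∫ x, gap M x ∂(P.alg.sel n fun i => h i) +
        ∫ z, g z ∂(P.alg.sel n (fun i => h i) ⊗ₘ M.k) ≤ P.midBound M T v κ t j 0 n w h := by
  have hκ := hB.κ_nonneg j
  have hl := hB.lo_nonneg j
  have hf := fm_mem_Icc M M.opt
  have hN : max 0 (-w) ≤ P.lo j := max_le hl (by linarith)
  have hN0 : 0 ≤ max 0 (-w) := le_max_left _ _
  have hq : (0 : ℝ) < 4 ^ j := by positivity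
  obtain ⟨f, hf'⟩ : ∃ f, T - n = f + 1 := ⟨T - n - 1, by omega⟩
  have hf'' : T - (n + 1) = f := by omega
  refine exists_affine_majorant M P.alg f n (fun i => h i)
    (a := v (j - 1) + 4 ^ j * (P.hi j + 1 - w) +
      κ j * ((max 0 (-w)) ^ 2 + 2 * (T - t) / 4 ^ j + 1))
    (b := -(4 ^ j + 2 * κ j * max 0 (-w)))
    (c := 4 ^ j + 1 + 2 * κ j * (P.lo j + 1)) (fun z hz => ?_) (fun d hd => ?_)
  · refine (hB.classBound_settle_pos hR ht hj0 hj le_rfl (by linarith [hz.2]) _).trans ?_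
    simp only [midBound, hf'', update_eq_histSnoc]
    have h0 : w + z.2.1 - fm M M.opt * ((4 ^ j : ℕ) : ℝ) / 4 ^ j =
        w + (z.2.1 - fm M M.opt) := by
      push_cast; field_simp; ring
    have h1 := sq_negPart_add_le w (z.2.1 - fm M M.opt)
    have h2 : (z.2.1 - fm M M.opt) ^ 2 ≤ 1 := by
      have := hz.1; have := hz.2; have := hf.1; have := hf.2
      nlinarith
    have h4 : 2 * ((T : ℝ) - ((t + 1 : ℕ) : ℝ)) / 4 ^ j ≤ 2 * (T - t) / 4 ^ j := by
      gcongr; simp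
    have h5 : ((4 ^ j : ℕ) : ℝ) / 4 ^ j = 1 := by push_cast; exact div_self hq.ne'
    have h3 : (max 0 (-(w + (z.2.1 - fm M M.opt)))) ^ 2 +
        2 * ((T : ℝ) - ((t + 1 : ℕ) : ℝ)) / 4 ^ j + 1 - ((4 ^ j : ℕ) : ℝ) / 4 ^ j ≤
        (max 0 (-w)) ^ 2 + 2 * (T - t) / 4 ^ j + 1 -
          2 * max 0 (-w) * (z.2.1 - fm M M.opt) := by linarith
    rw [h0]
    linarith [mul_le_mul_of_nonneg_left h3 hκ]
  · simp only [midBound, hf', Nat.cast_zero, mul_zero, zero_div, sub_zero]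
    linarith [mul_nonneg (mul_nonneg hκ hd) (by linarith : 0 ≤ P.lo j + 1 - max 0 (-w))]

lemma classBound_step_ref (hB : P.ClassBudget T R v κ) (hR : expRegret M P.alg T ≤ R)
    {t j k n : ℕ} (ht : t < T) (hj0 : 0 < j) (hj : j ≤ P.top) (hk0 : 0 < k) (hk : k ≤ 4 ^ j)
    {w : ℝ} (hw' : w ≤ P.hi j) (h : ℕ → X × ℝ × Y) :
    ∃ g : X × ℝ × Y → ℝ, Integrable g (Measure.dirac P.ref ⊗ₘ M.k) ∧
      (∀ z, z.2.1 ∈ Set.Icc (0 : ℝ) 1 →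
        P.classBound M T v κ (t + 1) (P.settle j (k - 1) n (w - z.2.1 / 4 ^ j) h) ≤ g z) ∧
      ∫ x, gap M x ∂(Measure.dirac P.ref) +
        ∫ z, g z ∂(Measure.dirac P.ref ⊗ₘ M.k) ≤ P.midBound M T v κ t j k n w h := by
  have hκ := hB.κ_nonneg j
  have hf := fm_mem_Icc M M.opt
  have hq : (1 : ℝ) ≤ 4 ^ j := one_le_pow₀ (by norm_num)
  have hq0 : (0 : ℝ) < 4 ^ j := by positivity
  set u : ℝ := w - fm M M.opt * k / 4 ^ j with hu
  have hN0 : 0 ≤ max 0 (-u) := le_max_left _ _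
  refine exists_affine_majorant_dirac M P.ref (a := P.midBound M T v κ t j k n w h)
    (b := 1 + 2 * κ j * max 0 (-u) / 4 ^ j) (fun z hz => ?_) ?_
  · have hz0 : 0 ≤ z.2.1 / 4 ^ j := div_nonneg hz.1 hq0.le
    refine (hB.classBound_settle_pos hR ht hj0 hj (by omega) (by linarith) _).trans ?_
    have hkc : ((k - 1 : ℕ) : ℝ) = k - 1 := by
      rw [Nat.cast_sub hk0]; simp
    have h0 : w - z.2.1 / 4 ^ j - fm M M.opt * ((k - 1 : ℕ) : ℝ) / 4 ^ j =
        u + -((z.2.1 - fm M M.opt) / 4 ^ j) := by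
      rw [hkc, hu]; field_simp; ring
    simp only [midBound]
    rw [h0, ← hu]
    have h1 := sq_negPart_add_le u (-((z.2.1 - fm M M.opt) / 4 ^ j))
    have h2 : (-((z.2.1 - fm M M.opt) / 4 ^ j)) ^ 2 ≤ 1 / 4 ^ j := by
      have h6 : (z.2.1 - fm M M.opt) ^ 2 ≤ 1 := by
        have := hz.1; have := hz.2; have := hf.1; have := hf.2
        nlinarith
      rw [neg_sq, div_pow, div_le_div_iff₀ (by positivity) hq0]
      nlinarith
    have h4 : 2 * ((T : ℝ) - ((t + 1 : ℕ) : ℝ)) / 4 ^ j = 2 * (T - t) / 4 ^ j - 2 / 4 ^ j := by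
      push_cast; ring
    have h5 : ((k - 1 : ℕ) : ℝ) / 4 ^ j = k / 4 ^ j - 1 / 4 ^ j := by rw [hkc]; ring
    have h7 : (2 : ℝ) / 4 ^ j = 1 / 4 ^ j + 1 / 4 ^ j := by ring
    have h3 : (max 0 (-(u + -((z.2.1 - fm M M.opt) / 4 ^ j)))) ^ 2 +
        2 * ((T : ℝ) - ((t + 1 : ℕ) : ℝ)) / 4 ^ j + 1 - ((k - 1 : ℕ) : ℝ) / 4 ^ j ≤
        (max 0 (-u)) ^ 2 + 2 * (T - t) / 4 ^ j + 1 - k / 4 ^ j +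
          2 * max 0 (-u) / 4 ^ j * (z.2.1 - fm M M.opt) := by
      rw [h4, h5]
      have h8 : 2 * max 0 (-u) * -((z.2.1 - fm M M.opt) / 4 ^ j) =
        -(2 * max 0 (-u) / 4 ^ j * (z.2.1 - fm M M.opt)) := by ring
      linarith
    have h9 : 4 ^ j * (P.hi j + 1 - (u + -((z.2.1 - fm M M.opt) / 4 ^ j))) =
        4 ^ j * (P.hi j + 1 - u) + (z.2.1 - fm M M.opt) := by
      field_simp; ring
    have h10 : (1 + 2 * κ j * max 0 (-u) / 4 ^ j) * (z.2.1 - fm M M.opt) =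
        (z.2.1 - fm M M.opt) + κ j * (2 * max 0 (-u) / 4 ^ j * (z.2.1 - fm M M.opt)) := by
      ring
    rw [h9, h10]
    linarith [mul_le_mul_of_nonneg_left h3 hκ]
  · have : 0 ≤ 2 * κ j * max 0 (-u) / 4 ^ j * gap M P.ref :=
      mul_nonneg (by positivity) (gap_nonneg M _)
    linarith

/-- Under a model for which the base algorithm has small regret, so does the level-switching
algorithm. -/
theorem expRegret_le (hB : P.ClassBudget T R v κ) (hR : expRegret M P.alg T ≤ R)
    (hb0 : 0 ≤ P.base) (hb : P.base ≤ fm M M.opt) (h₀ : ℕ → X × ℝ × Y) :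
    expRegret M (P.toStateAlg h₀).toRegAlg T ≤ v 0 := by
  refine ((P.toStateAlg h₀).expRegret_le_potential M T (P.classBound M T v κ) P.Valid
    ?_ ?_ ?_ ?_).trans (hB.classBound_fresh hR 0 0 (by omega) h₀)
  · exact ⟨by simp [toStateAlg], by simp [toStateAlg], by simp [toStateAlg],
      by simp [toStateAlg], by simpa [toStateAlg] using hB.lo_nonneg 0, by simp [toStateAlg]⟩
  · exact fun t s z hs => P.valid_update hB.lo_nonneg hB.hi_nonneg z hs
  · exact fun s hs => hB.classBound_nonneg hs
  rintro t ht ⟨⟨j, k, n⟩, w, h⟩ ⟨h1, h2, h3, h4, h5, h6⟩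
  simp only at h1 h2 h3 h4 h5 h6
  simp only [toStateAlg]
  by_cases hj : P.top < j
  · simp only [update, policy, classBound, hj, if_true, true_or]
    refine exists_affine_majorant_dirac M P.ref (a := T - t - 1) (b := 0) (fun z _ => ?_) ?_
    · push_cast; linarith
    · linarith [gap_le_one M P.ref]
  by_cases hk : 0 < k
  · have hj0 : 0 < j := Nat.pos_of_ne_zero fun h => by omega
    obtain ⟨g, hg, hle, hs⟩ := hB.classBound_step_ref hR ht hj0 (not_lt.1 hj) hk h2 (h6 hj0) h
      (n := n)
    have hW : P.classBound M T v κ t ((j, k, n), (w, h)) = P.midBound M T v κ t j k n w h := by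
      simp [classBound, hj, hj0.ne']
    rw [hW]
    simp only [update, policy, hj, hk, if_true, if_false, or_true]
    exact ⟨g, hg, fun z hz => by rw [clamp_of_mem hz]; exact hle z hz, hs⟩
  obtain rfl : k = 0 := by omega
  by_cases hj0 : j = 0
  · subst hj0
    obtain ⟨g, hg, hle, hs⟩ := hB.classBound_step_zero hR hb0 hb ht h4 h5 h
    simp only [update, policy, classBound, hj, if_true, if_false, or_false,
      lt_irrefl]
    exact ⟨g, hg, fun z hz => by
      rw [clamp_of_mem hz]; simpa only [classBound] using hle z hz, hs⟩
  · have hj0' := Nat.pos_of_ne_zero hj0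
    obtain ⟨g, hg, hle, hs⟩ := hB.classBound_step_base hR ht h4 hj0' (not_lt.1 hj) h5 (h6 hj0') h
    have hW : P.classBound M T v κ t ((j, 0, n), (w, h)) = P.midBound M T v κ t j 0 n w h := by
      simp [classBound, hj, hj0]
    rw [hW]
    simp only [update, policy, hj, hj0, if_false, or_false, lt_irrefl, sub_zero]
    exact ⟨g, hg, fun z hz => by rw [clamp_of_mem hz]; exact hle z hz, hs⟩

end ClassBudget

end SwitchParams

end Potentials

section RefPotential

variable {X Y : Type} [MeasurableSpace X] [MeasurableSpace Y]

namespace SwitchParams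

/-- Compatibility conditions between the thresholds of the level-switching algorithm and a bound
`u j` on the future regret of a run started at level `j`, when the reference decision is optimal
and its mean reward exceeds the baseline by at most `δ`. -/
structure RefBudget (P : SwitchParams X Y) (T : ℕ) (δ : ℝ) (u κ : ℕ → ℝ) : Prop where
  lo_nonneg : ∀ j, 0 ≤ P.lo j
  one_le_hi : ∀ j, j ≤ P.top → 1 ≤ P.hi j
  hi_nonneg : ∀ j, 0 ≤ P.hi j
  u_nonneg : ∀ j, 0 ≤ u j
  κ_nonneg : ∀ j, 0 ≤ κ j
  exit_pos : ∀ j, 0 < j → j ≤ P.top → u (j - 1) ≤ u (j + 1) + κ j * (P.hi j - 1) ^ 2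
  start_zero : u 1 + P.lo 0 + 1 + δ * T ≤ u 0
  start_pos : ∀ j, 0 < j → j ≤ P.top →
    u (j + 1) + P.lo j + 1 + κ j * (2 * T / 4 ^ j + 1) ≤ u j

/-- Bound on the future regret of the level-switching algorithm at an intermediate level, when the
reference decision is optimal. -/
def refMidBound (P : SwitchParams X Y) (M : Model X Y) (T : ℕ) (u κ : ℕ → ℝ)
    (t j k : ℕ) (w : ℝ) : ℝ :=
  u (j + 1) + (w - fm M M.opt * k / 4 ^ j + P.lo j + 1) +
    κ j * ((max 0 (w - fm M M.opt * k / 4 ^ j)) ^ 2 + 2 * (T - t) / 4 ^ j + 1 - k / 4 ^ j)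

/-- Bound on the future regret of the level-switching algorithm when the reference decision is
optimal. -/
def refBound (P : SwitchParams X Y) (M : Model X Y) (T : ℕ) (δ : ℝ) (u κ : ℕ → ℝ)
    (t : ℕ) (s : SwitchState X Y) : ℝ :=
  if P.top < s.1.1 then 0
  else if s.1.1 = 0 then u 1 + (s.2.1 + P.lo 0 + 1) + δ * (T - t)
  else P.refMidBound M T u κ t s.1.1 s.1.2.1 s.2.1

namespace RefBudget

variable {P : SwitchParams X Y} {M : Model X Y} {T : ℕ} {δ : ℝ} {u κ : ℕ → ℝ}

lemma refBound_fresh (hB : P.RefBudget T δ u κ) (hδ : 0 ≤ δ) (t j : ℕ) (h : ℕ → X × ℝ × Y) :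
    P.refBound M T δ u κ t ((j, 0, 0), (0, h)) ≤ u j := by
  have ht : (0 : ℝ) ≤ t := Nat.cast_nonneg t
  have hκ := hB.κ_nonneg j
  unfold refBound
  split_ifs with h1 h2
  · exact hB.u_nonneg j
  · obtain rfl : j = 0 := h2
    have h3 := hB.start_zero
    simp only
    nlinarith
  · have h3 := hB.start_pos j (Nat.pos_of_ne_zero h2) (not_lt.1 h1)
    have h5 : κ j * (2 * (T - t) / 4 ^ j + 1) ≤ κ j * (2 * T / 4 ^ j + 1) := by
      gcongr; linarith
    simp only [refMidBound, Nat.cast_zero, mul_zero, zero_div, sub_zero, max_self]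
    nlinarith

lemma refBound_settle_zero (hB : P.RefBudget T δ u κ) (hδ : 0 ≤ δ)
    {t n : ℕ} (ht : t ≤ T) {w : ℝ} (hw : -P.lo 0 - 1 ≤ w) (h : ℕ → X × ℝ × Y) :
    P.refBound M T δ u κ t (P.settle 0 0 n w h) ≤ u 1 + (w + P.lo 0 + 1) + δ * (T - t) := by
  have ht' : (t : ℝ) ≤ T := by exact_mod_cast ht
  refine P.le_of_settle (V := P.refBound M T δ u κ t) (fun _ => ?_)
    (fun h0 => absurd h0 (lt_irrefl 0)) ?_
  · refine (hB.refBound_fresh hδ t 1 h).trans ?_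
    linarith [mul_nonneg hδ (sub_nonneg.2 ht')]
  · simp [refBound]

lemma refBound_settle_pos (hB : P.RefBudget T δ u κ) (hδ : 0 ≤ δ)
    {t j k n : ℕ} (ht : t ≤ T) (hj0 : 0 < j) (hj : j ≤ P.top) (hk : k ≤ 4 ^ j) {w : ℝ}
    (hw : -P.lo j - 1 ≤ w - fm M M.opt * k / 4 ^ j) (h : ℕ → X × ℝ × Y) :
    P.refBound M T δ u κ t (P.settle j k n w h) ≤ P.refMidBound M T u κ t j k w := by
  have hκ := hB.κ_nonneg j
  have hf := fm_mem_Icc M M.opt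
  have ht' : (t : ℝ) ≤ T := by exact_mod_cast ht
  have hk' : (k : ℝ) / 4 ^ j ≤ 1 := by
    rw [div_le_one (by positivity)]; exact_mod_cast hk
  have hfk : fm M M.opt * k / 4 ^ j ≤ 1 := by
    rw [mul_div_assoc]
    exact mul_le_one₀ hf.2 (by positivity) hk'
  have hs : 0 ≤ 2 * ((T : ℝ) - t) / 4 ^ j := by
    have := sub_nonneg.2 ht'; positivity
  refine P.le_of_settle (V := P.refBound M T δ u κ t) (fun _ => ?_) (fun _ hw' => ?_) ?_
  · refine (hB.refBound_fresh hδ t (j + 1) h).trans ?_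
    have h1 : 0 ≤ (max 0 (w - fm M M.opt * k / 4 ^ j)) ^ 2 +
        2 * (T - t) / 4 ^ j + 1 - k / 4 ^ j := by
      nlinarith [sq_nonneg (max 0 (w - fm M M.opt * k / 4 ^ j))]
    unfold refMidBound
    linarith [mul_nonneg hκ h1]
  · refine (hB.refBound_fresh hδ t (j - 1) h).trans ((hB.exit_pos j hj0 hj).trans ?_)
    have hh := hB.one_le_hi j hj
    have hle : P.hi j - 1 ≤ max 0 (w - fm M M.opt * k / 4 ^ j) :=
      le_max_of_le_right (by linarith)
    have h1 : (P.hi j - 1) ^ 2 ≤ (max 0 (w - fm M M.opt * k / 4 ^ j)) ^ 2 +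
        2 * (T - t) / 4 ^ j + 1 - k / 4 ^ j := by nlinarith
    unfold refMidBound
    linarith [mul_le_mul_of_nonneg_left h1 hκ]
  · simp [refBound, not_lt.2 hj, hj0.ne']

lemma refBound_nonneg (hB : P.RefBudget T δ u κ) {s : SwitchState X Y}
    (hs : P.Valid T s) : 0 ≤ P.refBound M T δ u κ T s := by
  obtain ⟨⟨j, k, n⟩, w, h⟩ := s
  obtain ⟨-, hk, -, -, hw, -⟩ := hs
  simp only at hk hw
  have hκ := hB.κ_nonneg j
  have hf := fm_mem_Icc M M.opt
  unfold refBound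
  split_ifs with h1 h2
  · exact le_rfl
  · obtain rfl : j = 0 := h2
    simp only [sub_self, mul_zero]
    linarith [hB.u_nonneg 1]
  · have hk' : (k : ℝ) / 4 ^ j ≤ 1 := by
      rw [div_le_one (by positivity)]; exact_mod_cast hk
    have hfk : fm M M.opt * k / 4 ^ j ≤ 1 := by
      rw [mul_div_assoc]
      exact mul_le_one₀ hf.2 (by positivity) hk'
    have h4 : 0 ≤ (max 0 (w - fm M M.opt * k / 4 ^ j)) ^ 2 + 2 * (T - T) / 4 ^ j + 1 -
        k / 4 ^ j := by
      rw [sub_self, mul_zero, zero_div]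
      linarith [sq_nonneg (max 0 (w - fm M M.opt * k / 4 ^ j))]
    simp only [refMidBound]
    linarith [hB.u_nonneg (j + 1), mul_nonneg hκ h4]

lemma refBound_step_zero (hB : P.RefBudget T δ u κ) (hδ : 0 ≤ δ)
    (hb1 : P.base ≤ 1) (hb : fm M M.opt ≤ P.base + δ) {t n : ℕ} (ht : t < T) {w : ℝ}
    (hw : -P.lo 0 ≤ w) (h : ℕ → X × ℝ × Y) :
    ∃ g : X × ℝ × Y → ℝ, Integrable g (P.alg.sel n (fun i => h i) ⊗ₘ M.k) ∧
      (∀ z, z.2.1 ∈ Set.Icc (0 : ℝ) 1 →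
        P.refBound M T δ u κ (t + 1)
          (P.settle 0 0 (n + 1) (w + z.2.1 - P.base) (Function.update h n z)) ≤ g z) ∧
      ∫ x, gap M x ∂(P.alg.sel n fun i => h i) +
        ∫ z, g z ∂(P.alg.sel n (fun i => h i) ⊗ₘ M.k) ≤
          u 1 + (w + P.lo 0 + 1) + δ * (T - t) := by
  refine exists_affine_majorant M P.alg 0 n (fun i => h i)
    (a := u 1 + (w + P.lo 0 + 1) + δ * (T - t)) (b := 1) (c := 0) (fun z hz => ?_)
    (fun d _ => by linarith)
  refine (hB.refBound_settle_zero hδ ht (by linarith [hz.1]) _).trans ?_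
  push_cast
  linarith

lemma refBound_step_base (hB : P.RefBudget T δ u κ) (hδ : 0 ≤ δ)
    {t j n : ℕ} (ht : t < T) (hj0 : 0 < j) (hj : j ≤ P.top) {w : ℝ}
    (hw : -P.lo j ≤ w) (h : ℕ → X × ℝ × Y) :
    ∃ g : X × ℝ × Y → ℝ, Integrable g (P.alg.sel n (fun i => h i) ⊗ₘ M.k) ∧
      (∀ z, z.2.1 ∈ Set.Icc (0 : ℝ) 1 →
        P.refBound M T δ u κ (t + 1)
          (P.settle j (4 ^ j) (n + 1) (w + z.2.1) (Function.update h n z)) ≤ g z) ∧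
      ∫ x, gap M x ∂(P.alg.sel n fun i => h i) +
        ∫ z, g z ∂(P.alg.sel n (fun i => h i) ⊗ₘ M.k) ≤ P.refMidBound M T u κ t j 0 w := by
  have hκ := hB.κ_nonneg j
  have hf := fm_mem_Icc M M.opt
  have hN0 : 0 ≤ max 0 w := le_max_left _ _
  have hq : (0 : ℝ) < 4 ^ j := by positivity
  refine exists_affine_majorant M P.alg 0 n (fun i => h i)
    (a := P.refMidBound M T u κ t j 0 w) (b := 1 + 2 * κ j * max 0 w) (c := 0)
    (fun z hz => ?_) (fun d hd => ?_)
  · have h0 : w + z.2.1 - fm M M.opt * ((4 ^ j : ℕ) : ℝ) / 4 ^ j =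
        w + (z.2.1 - fm M M.opt) := by
      push_cast; field_simp; ring
    refine (hB.refBound_settle_pos hδ ht hj0 hj le_rfl
      (by rw [h0]; linarith [hz.1, hf.2]) _).trans ?_
    simp only [refMidBound, Nat.cast_zero, mul_zero, zero_div, sub_zero]
    have h1 := sq_posPart_add_le w (z.2.1 - fm M M.opt)
    have h2 : (z.2.1 - fm M M.opt) ^ 2 ≤ 1 := by
      have := hz.1; have := hz.2; have := hf.1; have := hf.2
      nlinarith
    have h4 : 2 * ((T : ℝ) - ((t + 1 : ℕ) : ℝ)) / 4 ^ j ≤ 2 * (T - t) / 4 ^ j := by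
      gcongr; simp
    have h5 : ((4 ^ j : ℕ) : ℝ) / 4 ^ j = 1 := by push_cast; exact div_self hq.ne'
    have h3 : (max 0 (w + (z.2.1 - fm M M.opt))) ^ 2 +
        2 * ((T : ℝ) - ((t + 1 : ℕ) : ℝ)) / 4 ^ j + 1 - ((4 ^ j : ℕ) : ℝ) / 4 ^ j ≤
        (max 0 w) ^ 2 + 2 * (T - t) / 4 ^ j + 1 +
          2 * max 0 w * (z.2.1 - fm M M.opt) := by linarith
    rw [h0]
    linarith [mul_le_mul_of_nonneg_left h3 hκ]
  · linarith [mul_nonneg (mul_nonneg hκ hN0) hd]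

lemma refBound_step_ref (hB : P.RefBudget T δ u κ) (hδ : 0 ≤ δ) (hgap : gap M P.ref = 0)
    {t j k n : ℕ} (ht : t < T) (hj0 : 0 < j) (hj : j ≤ P.top) (hk0 : 0 < k) (hk : k ≤ 4 ^ j)
    {w : ℝ} (hw : -P.lo j ≤ w) (h : ℕ → X × ℝ × Y) :
    ∃ g : X × ℝ × Y → ℝ, Integrable g (Measure.dirac P.ref ⊗ₘ M.k) ∧
      (∀ z, z.2.1 ∈ Set.Icc (0 : ℝ) 1 →
        P.refBound M T δ u κ (t + 1) (P.settle j (k - 1) n (w - z.2.1 / 4 ^ j) h) ≤ g z) ∧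
      ∫ x, gap M x ∂(Measure.dirac P.ref) +
        ∫ z, g z ∂(Measure.dirac P.ref ⊗ₘ M.k) ≤ P.refMidBound M T u κ t j k w := by
  have hκ := hB.κ_nonneg j
  have hf := fm_mem_Icc M M.opt
  have hq : (1 : ℝ) ≤ 4 ^ j := one_le_pow₀ (by norm_num)
  have hq0 : (0 : ℝ) < 4 ^ j := by positivity
  set y : ℝ := w - fm M M.opt * k / 4 ^ j with hy
  refine exists_affine_majorant_dirac M P.ref (a := P.refMidBound M T u κ t j k w)
    (b := -(1 + 2 * κ j * max 0 y) / 4 ^ j) (fun z hz => ?_) (by rw [hgap]; simp)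
  have hkc : ((k - 1 : ℕ) : ℝ) = k - 1 := by
    rw [Nat.cast_sub hk0]; simp
  have h0 : w - z.2.1 / 4 ^ j - fm M M.opt * ((k - 1 : ℕ) : ℝ) / 4 ^ j =
      y + -((z.2.1 - fm M M.opt) / 4 ^ j) := by
    rw [hkc, hy]; field_simp; ring
  have hwt : -P.lo j - 1 ≤ w - z.2.1 / 4 ^ j - fm M M.opt * ((k - 1 : ℕ) : ℝ) / 4 ^ j := by
    have hk1 : (1 : ℝ) ≤ k := by exact_mod_cast hk0
    have hkq : (k : ℝ) ≤ 4 ^ j := by exact_mod_cast hk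
    have h1 : (z.2.1 + fm M M.opt * (k - 1)) / 4 ^ j ≤ 1 := by
      rw [div_le_one hq0]
      nlinarith [hz.2, hf.2]
    have h2 : z.2.1 / 4 ^ j + fm M M.opt * (k - 1) / 4 ^ j =
        (z.2.1 + fm M M.opt * (k - 1)) / 4 ^ j := by ring
    rw [hkc]
    linarith
  refine (hB.refBound_settle_pos hδ ht hj0 hj (by omega) hwt _).trans ?_
  simp only [refMidBound]
  rw [h0, ← hy]
  have h1 := sq_posPart_add_le y (-((z.2.1 - fm M M.opt) / 4 ^ j))
  have h2 : (-((z.2.1 - fm M M.opt) / 4 ^ j)) ^ 2 ≤ 1 / 4 ^ j := by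
    have h6 : (z.2.1 - fm M M.opt) ^ 2 ≤ 1 := by
      have := hz.1; have := hz.2; have := hf.1; have := hf.2
      nlinarith
    rw [neg_sq, div_pow, div_le_div_iff₀ (by positivity) hq0]
    nlinarith
  have h4 : 2 * ((T : ℝ) - ((t + 1 : ℕ) : ℝ)) / 4 ^ j = 2 * (T - t) / 4 ^ j - 2 / 4 ^ j := by
    push_cast; ring
  have h5 : ((k - 1 : ℕ) : ℝ) / 4 ^ j = k / 4 ^ j - 1 / 4 ^ j := by rw [hkc]; ring
  have h7 : (2 : ℝ) / 4 ^ j = 1 / 4 ^ j + 1 / 4 ^ j := by ring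
  have h3 : (max 0 (y + -((z.2.1 - fm M M.opt) / 4 ^ j))) ^ 2 +
      2 * ((T : ℝ) - ((t + 1 : ℕ) : ℝ)) / 4 ^ j + 1 - ((k - 1 : ℕ) : ℝ) / 4 ^ j ≤
      (max 0 y) ^ 2 + 2 * (T - t) / 4 ^ j + 1 - k / 4 ^ j +
        2 * max 0 y * -((z.2.1 - fm M M.opt) / 4 ^ j) := by
    rw [h4, h5]
    linarith
  have h10 : -(1 + 2 * κ j * max 0 y) / 4 ^ j * (z.2.1 - fm M M.opt) =
      -((z.2.1 - fm M M.opt) / 4 ^ j) +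
        κ j * (2 * max 0 y * -((z.2.1 - fm M M.opt) / 4 ^ j)) := by
    ring
  rw [h10]
  linarith [mul_le_mul_of_nonneg_left h3 hκ]

/-- The level-switching algorithm has small regret when the reference decision is optimal. -/
theorem expRegret_le (hB : P.RefBudget T δ u κ) (hδ : 0 ≤ δ) (hgap : gap M P.ref = 0)
    (hb1 : P.base ≤ 1) (hb : fm M M.opt ≤ P.base + δ) (h₀ : ℕ → X × ℝ × Y) :
    expRegret M (P.toStateAlg h₀).toRegAlg T ≤ u 0 := by
  refine ((P.toStateAlg h₀).expRegret_le_potential M T (P.refBound M T δ u κ) P.Valid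
    ?_ ?_ ?_ ?_).trans (hB.refBound_fresh hδ 0 0 h₀)
  · exact ⟨by simp [toStateAlg], by simp [toStateAlg], by simp [toStateAlg],
      by simp [toStateAlg], by simpa [toStateAlg] using hB.lo_nonneg 0, by simp [toStateAlg]⟩
  · exact fun t s z hs => P.valid_update hB.lo_nonneg hB.hi_nonneg z hs
  · exact fun s hs => hB.refBound_nonneg hs
  rintro t ht ⟨⟨j, k, n⟩, w, h⟩ ⟨h1, h2, h3, h4, h5, h6⟩
  simp only at h1 h2 h3 h4 h5 h6
  simp only [toStateAlg]
  by_cases hj : P.top < j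
  · simp only [update, policy, refBound, hj, if_true, true_or]
    exact exists_affine_majorant_dirac M P.ref (a := 0) (b := 0) (fun z _ => by simp)
      (by simp [hgap])
  by_cases hk : 0 < k
  · have hj0 : 0 < j := Nat.pos_of_ne_zero fun h => by omega
    obtain ⟨g, hg, hle, hs⟩ := hB.refBound_step_ref hδ hgap ht hj0 (not_lt.1 hj) hk h2 h5 h
      (n := n)
    have hW : P.refBound M T δ u κ t ((j, k, n), (w, h)) = P.refMidBound M T u κ t j k w := by
      simp [refBound, hj, hj0.ne']
    rw [hW]
    simp only [update, policy, hj, hk, if_true, if_false, or_true]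
    exact ⟨g, hg, fun z hz => by rw [clamp_of_mem hz]; exact hle z hz, hs⟩
  obtain rfl : k = 0 := by omega
  by_cases hj0 : j = 0
  · subst hj0
    obtain ⟨g, hg, hle, hs⟩ := hB.refBound_step_zero hδ hb1 hb ht h5 h (n := n)
    simp only [update, policy, refBound, hj, if_true, if_false, or_false, lt_irrefl]
    exact ⟨g, hg, fun z hz => by
      rw [clamp_of_mem hz]; simpa only [refBound] using hle z hz, hs⟩
  · have hj0' := Nat.pos_of_ne_zero hj0
    obtain ⟨g, hg, hle, hs⟩ := hB.refBound_step_base hδ ht hj0' (not_lt.1 hj) h5 h (n := n)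
    have hW : P.refBound M T δ u κ t ((j, 0, n), (w, h)) = P.refMidBound M T u κ t j 0 w := by
      simp [refBound, hj, hj0]
    rw [hW]
    simp only [update, policy, hj, hj0, if_false, or_false, lt_irrefl, sub_zero]
    exact ⟨g, hg, fun z hz => by rw [clamp_of_mem hz]; exact hle z hz, hs⟩

end RefBudget

end SwitchParams

end RefPotential

section Parameters

variable {X Y : Type} [MeasurableSpace X] [MeasurableSpace Y]

/-- The level-switching algorithm with thresholds tuned to a base algorithm of regret `R` and a
slack `S`. -/
def switchParams (A : RegAlg X Y) (x₀ : X) (J : ℕ) (R S b : ℝ) : SwitchParams X Y where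
  alg := A
  ref := x₀
  top := J
  lo j := 128 * (R + S / 2 ^ j)
  hi j := 9 * (S / 2 ^ j)
  base := b

/-- Regret budget of a level under a model of the class. -/
def classLevel (R S : ℝ) (j : ℕ) : ℝ := 22 * (S * (2 * 2 ^ j - 1) + R * (4 * 4 ^ j - 1) / 3)

/-- Weight of the quadratic part of the potential at a level under a model of the class. -/
def classWeight (R S : ℝ) (j : ℕ) : ℝ :=
  22 * 4 ^ j * (3 * (S / 2 ^ j) + 5 * R) / (128 * (R + S / 2 ^ j)) ^ 2

lemma four_pow_eq (j : ℕ) : (4 : ℝ) ^ j = (2 ^ j) ^ 2 := by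
  rw [← pow_mul, mul_comm, pow_mul]; norm_num

lemma classWeight_mul_sq {R S : ℝ} (hR : 0 ≤ R) (hS : 0 < S) (j : ℕ) :
    classWeight R S j * (128 * (R + S / 2 ^ j)) ^ 2 =
      22 * 4 ^ j * (3 * (S / 2 ^ j) + 5 * R) := by
  have : 0 < R + S / 2 ^ j := by positivity
  unfold classWeight
  field_simp

lemma classWeight_nonneg {R S : ℝ} (hR : 0 ≤ R) (hS : 0 < S) (j : ℕ) :
    0 ≤ classWeight R S j := by
  unfold classWeight; positivity

lemma classWeight_mul_le {R S : ℝ} (hR : 0 ≤ R) (hS : 0 < S) (j : ℕ) :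
    classWeight R S j * (R + S / 2 ^ j) ≤ 4 ^ j / 128 := by
  have hL : 0 < R + S / 2 ^ j := by positivity
  have h := classWeight_mul_sq hR hS j
  have hσ : 0 < S / 2 ^ j := by positivity
  have hq : (0 : ℝ) < 4 ^ j := by positivity
  refine le_of_mul_le_mul_right ?_ hL
  nlinarith [mul_pos hq hσ, mul_nonneg hq.le hR]

lemma classWeight_start_le {R S T : ℝ} (hR : 0 ≤ R) {j : ℕ} (hj : 1 ≤ S / 2 ^ j)
    (hT : T ≤ S ^ 2) :
    2 * classWeight R S j * (128 * (R + S / 2 ^ j) + 1) * R +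
      classWeight R S j * (2 * T / 4 ^ j + 1) ≤ 3 * 4 ^ j * (R + S / 2 ^ j) := by
  have hS : 0 < S := by
    by_contra h
    have : S / 2 ^ j ≤ 0 := div_nonpos_of_nonpos_of_nonneg (not_lt.1 h) (by positivity)
    linarith
  have hc := classWeight_mul_le hR hS j
  have hc0 := classWeight_nonneg hR hS j
  have hTj : T / 4 ^ j ≤ (S / 2 ^ j) ^ 2 := by
    rw [div_pow, ← four_pow_eq]; gcongr
  set c := classWeight R S j
  set σ := S / 2 ^ j
  have h1 : c * (128 * (R + σ) + 1) ≤ c * (129 * (R + σ)) := by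
    gcongr; linarith
  have h2 : c * (2 * T / 4 ^ j + 1) ≤ c * (3 * (R + σ) * σ) := by
    refine mul_le_mul_of_nonneg_left ?_ hc0
    rw [mul_div_assoc]
    nlinarith
  have hq : (0 : ℝ) < 4 ^ j := by positivity
  have h3 : c * (128 * (R + σ) + 1) * R ≤ 129 * (4 ^ j / 128) * R := by
    refine mul_le_mul_of_nonneg_right ?_ hR
    linarith
  have h4 : c * (R + σ) * σ ≤ 4 ^ j / 128 * σ := by gcongr
  nlinarith [mul_nonneg hq.le hR, mul_nonneg hq.le (by linarith : 0 ≤ σ)]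

lemma classBudget_switchParams (A : RegAlg X Y) (x₀ : X) {J T : ℕ} {R S : ℝ} (b : ℝ) (hR : 0 ≤ R)
    (hJ : 2 ^ J ≤ S) (hT : T ≤ S ^ 2) (hTJ : T ≤ S * 2 ^ (J + 1)) :
    (switchParams A x₀ J R S b).ClassBudget T R (classLevel R S) (classWeight R S) := by
  have hS : 0 < S := lt_of_lt_of_le (by positivity) hJ
  have hσ : ∀ j ≤ J, 1 ≤ S / 2 ^ j := fun j hj => by
    rw [one_le_div (by positivity)]
    exact le_trans (pow_le_pow_right₀ (by norm_num) hj) hJ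
  refine ⟨fun j => ?_, fun j => ?_, fun j => ?_, classWeight_nonneg hR hS, ?_, fun j hj0 hj => ?_,
    ?_, fun j hj0 hj => ?_, ?_⟩ <;> try simp only [switchParams] at *
  · positivity
  · positivity
  · have h1 : (1 : ℝ) ≤ 2 ^ j := one_le_pow₀ (by norm_num)
    have h2 : (1 : ℝ) ≤ 4 ^ j := one_le_pow₀ (by norm_num)
    have h3 : (0 : ℝ) ≤ 2 * 2 ^ j - 1 := by linarith
    have h4 : (0 : ℝ) ≤ 4 * 4 ^ j - 1 := by linarith
    unfold classLevel; positivity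
  · rw [classWeight_mul_sq hR hS]
    simp only [classLevel]
    norm_num
    linarith
  · rw [classWeight_mul_sq hR hS]
    obtain ⟨i, rfl⟩ : ∃ i, j = i + 1 := ⟨j - 1, by omega⟩
    have h1 : (4 : ℝ) ^ (i + 1) * (S / 2 ^ (i + 1)) = S * 2 ^ (i + 1) := by
      rw [four_pow_eq]; field_simp
    simp only [classLevel, Nat.add_sub_cancel]
    rw [show 22 * 4 ^ (i + 1) * (3 * (S / 2 ^ (i + 1)) + 5 * R) =
      22 * (3 * (4 ^ (i + 1) * (S / 2 ^ (i + 1))) + 5 * (R * 4 ^ (i + 1))) by ring, h1]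
    apply le_of_eq
    ring
  · have h := classWeight_start_le hR (hσ 0 (by omega)) hT
    have hc := classWeight_nonneg hR hS 0
    simp only [classLevel, pow_zero, div_one] at h ⊢
    nlinarith [mul_nonneg hc (Nat.cast_nonneg (α := ℝ) T)]
  · have h := classWeight_start_le hR (hσ j hj) hT
    have hj1 := hσ j hj
    have h2 : (1 : ℝ) ≤ 4 ^ j := one_le_pow₀ (by norm_num)
    have h3 : classLevel R S j = classLevel R S (j - 1) + 22 * 4 ^ j * (R + S / 2 ^ j) := by
      obtain ⟨i, rfl⟩ : ∃ i, j = i + 1 := ⟨j - 1, by omega⟩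
      have h1 : (4 : ℝ) ^ (i + 1) * (S / 2 ^ (i + 1)) = S * 2 ^ (i + 1) := by
        rw [four_pow_eq]; field_simp
      simp only [classLevel, Nat.add_sub_cancel]
      rw [show 22 * 4 ^ (i + 1) * (R + S / 2 ^ (i + 1)) =
        22 * (R * 4 ^ (i + 1) + 4 ^ (i + 1) * (S / 2 ^ (i + 1))) by ring, h1]
      ring
    rw [h3]
    have h4 : (4 : ℝ) ^ j * (9 * (S / 2 ^ j) + 1) ≤ 4 ^ j * (10 * (S / 2 ^ j)) := by
      gcongr; linarith
    have h5 : R ≤ 4 ^ j * R := le_mul_of_one_le_left hR h2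
    have h6 : 0 ≤ 4 ^ j * (S / 2 ^ j) := by positivity
    nlinarith
  · refine hTJ.trans ?_
    have h1 : (1 : ℝ) ≤ 2 ^ (J + 1) := one_le_pow₀ (by norm_num)
    have h2 : (1 : ℝ) ≤ 4 ^ (J + 1) := one_le_pow₀ (by norm_num)
    unfold classLevel
    nlinarith [mul_le_mul_of_nonneg_left h1 hS.le, mul_le_mul_of_nonneg_left h2 hR]

/-- Regret budget of a level when the reference decision is optimal. -/
def refLevel (R S : ℝ) (J j : ℕ) : ℝ := 258 * ∑ i ∈ Finset.Ico j (J + 1), (R + S / 2 ^ i)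

/-- Weight of the quadratic part of the potential at a level when the reference decision is
optimal. -/
def refWeight (R S : ℝ) (J j : ℕ) : ℝ :=
  (refLevel R S J (j - 1) - refLevel R S J (j + 1)) / (9 * (S / 2 ^ j) - 1) ^ 2

lemma refLevel_eq_add {J j : ℕ} (R S : ℝ) (hj : j ≤ J) :
    refLevel R S J j = 258 * (R + S / 2 ^ j) + refLevel R S J (j + 1) := by
  unfold refLevel
  rw [Finset.sum_eq_sum_Ico_succ_bot (by omega), mul_add]

lemma refLevel_antitone {R S : ℝ} (hR : 0 ≤ R) (hS : 0 ≤ S) (J : ℕ) :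
    Antitone (refLevel R S J) := fun i j hij => by
  unfold refLevel
  refine mul_le_mul_of_nonneg_left ?_ (by norm_num)
  exact Finset.sum_le_sum_of_subset_of_nonneg (Finset.Ico_subset_Ico_left hij)
    fun i _ _ => by positivity

lemma refLevel_zero_le {R S : ℝ} (hS : 0 ≤ S) (J : ℕ) :
    refLevel R S J 0 ≤ 258 * ((J + 1) * R + 2 * S) := by
  have h : ∑ i ∈ Finset.range (J + 1), S / 2 ^ i ≤ 2 * S := by
    have h1 := sum_geometric_two_le (J + 1)
    have h2 : ∑ i ∈ Finset.range (J + 1), S / 2 ^ i =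
        S * ∑ i ∈ Finset.range (J + 1), (1 / 2 : ℝ) ^ i := by
      rw [Finset.mul_sum]
      exact Finset.sum_congr rfl fun i _ => by rw [one_div, inv_pow, div_eq_mul_inv]
    rw [h2]; nlinarith
  unfold refLevel
  rw [← Finset.range_eq_Ico, Finset.sum_add_distrib]
  simp only [Finset.sum_const, Finset.card_range, nsmul_eq_mul]
  push_cast
  linarith

lemma refBudget_switchParams (A : RegAlg X Y) (x₀ : X) {J T : ℕ} {R S δ : ℝ} (b : ℝ) (hR : 0 ≤ R)
    (hJ : 2 ^ J ≤ S) (hT : T ≤ S ^ 2) (hδT : δ * T ≤ S) :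
    (switchParams A x₀ J R S b).RefBudget T δ (refLevel R S J) (refWeight R S J) := by
  have hS : 0 < S := lt_of_lt_of_le (by positivity) hJ
  have hσ : ∀ j ≤ J, 1 ≤ S / 2 ^ j := fun j hj => by
    rw [one_le_div (by positivity)]
    exact le_trans (pow_le_pow_right₀ (by norm_num) hj) hJ
  have hanti := refLevel_antitone hR hS.le J
  refine ⟨fun j => ?_, fun j hj => ?_, fun j => ?_, fun j => ?_, fun j => ?_, fun j hj0 hj => ?_,
    ?_, fun j hj0 hj => ?_⟩ <;> try simp only [switchParams] at *
  · positivity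
  · linarith [hσ j hj]
  · positivity
  · unfold refLevel
    exact mul_nonneg (by norm_num) (Finset.sum_nonneg fun i _ => by positivity)
  · exact div_nonneg (sub_nonneg.2 (hanti (by omega))) (sq_nonneg _)
  · have h1 := hσ j hj
    have h2 : 0 < 9 * (S / 2 ^ j) - 1 := by linarith
    unfold refWeight
    rw [div_mul_cancel₀ _ (by positivity)]
    linarith
  · rw [refLevel_eq_add R S (Nat.zero_le J)]
    have h1 := hσ 0 (Nat.zero_le J)
    simp only [pow_zero, div_one, zero_add] at *
    linarith
  · have h1 := hσ j hj
    have hTj : (T : ℝ) / 4 ^ j ≤ (S / 2 ^ j) ^ 2 := by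
      rw [div_pow, ← four_pow_eq]; gcongr
    have h2 : refLevel R S J (j - 1) - refLevel R S J (j + 1) ≤ 258 * (3 * (R + S / 2 ^ j)) := by
      obtain ⟨i, rfl⟩ : ∃ i, j = i + 1 := ⟨j - 1, by omega⟩
      rw [Nat.add_sub_cancel, refLevel_eq_add R S (by omega : i ≤ J), refLevel_eq_add R S hj]
      have h3 : S / 2 ^ i = 2 * (S / 2 ^ (i + 1)) := by rw [pow_succ]; field_simp
      rw [h3]
      linarith
    rw [refLevel_eq_add R S hj]
    unfold refWeight
    set σ := S / 2 ^ j
    have h3 : refLevel R S J (j - 1) - refLevel R S J (j + 1) ≥ 0 :=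
      sub_nonneg.2 (hanti (by omega))
    have h4 : (refLevel R S J (j - 1) - refLevel R S J (j + 1)) / (9 * σ - 1) ^ 2 *
        (2 * T / 4 ^ j + 1) ≤ 258 * (3 * (R + σ)) * (3 / 64) := by
      rw [div_mul_eq_mul_div, mul_div_assoc]
      refine mul_le_mul h2 ?_ (by positivity) (by positivity)
      rw [div_le_div_iff₀ (by nlinarith) (by norm_num), mul_div_assoc]
      nlinarith
    linarith

end Parameters

section Minimax

variable {X Y : Type} [MeasurableSpace X] [MeasurableSpace Y]

lemma expRegret_mem_Icc (M : Model X Y) (A : RegAlg X Y) (T : ℕ) :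
    expRegret M A T ∈ Set.Icc (0 : ℝ) T := by
  rw [expRegret_eq_futureRegret M A T fun i => i.elim0]
  exact futureRegret_mem_Icc _ _ _ _ _

lemma iSup_expRegret_le {𝓜 : Set (Model X Y)} {A : RegAlg X Y} {T : ℕ} {B : ℝ}
    (hB : 0 ≤ B) (h : ∀ M ∈ 𝓜, expRegret M A T ≤ B) : ⨆ M ∈ 𝓜, expRegret M A T ≤ B :=
  Real.iSup_le (fun M => Real.iSup_le (h M) hB) hB

lemma iSup_expRegret_nonneg (𝓜 : Set (Model X Y)) (A : RegAlg X Y) (T : ℕ) :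
    0 ≤ ⨆ M ∈ 𝓜, expRegret M A T :=
  Real.iSup_nonneg fun M => Real.iSup_nonneg fun _ => (expRegret_mem_Icc M A T).1

lemma expRegret_le_iSup {𝓜 : Set (Model X Y)} (A : RegAlg X Y) (T : ℕ) {M : Model X Y}
    (hM : M ∈ 𝓜) : expRegret M A T ≤ ⨆ M ∈ 𝓜, expRegret M A T := by
  have hbdd : BddAbove (Set.range fun M : Model X Y => ⨆ _ : M ∈ 𝓜, expRegret M A T) := by
    refine ⟨T, ?_⟩
    rintro _ ⟨M, rfl⟩
    exact Real.iSup_le (fun _ => (expRegret_mem_Icc M A T).2) (Nat.cast_nonneg T)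
  have h := le_ciSup hbdd M
  simpa only [ciSup_pos hM] using h

/-- A regret algorithm for a class can be turned into one for the class enlarged by a model whose
optimal value exceeds the optimal values in the class by at most `δ`. -/
theorem exists_regAlg_union_singleton {𝓜 : Set (Model X Y)} {T : ℕ} (hT : 1 ≤ T) {δ : ℝ}
    {Mbar : Model X Y} (hδ : 0 < δ) (hM : ∀ M ∈ 𝓜, fm Mbar Mbar.opt ≤ fm M M.opt + δ)
    (A : RegAlg X Y) {R : ℝ} (hR : 0 ≤ R) (hA : ∀ M ∈ 𝓜, expRegret M A T ≤ R) :
    ∃ A' : RegAlg X Y,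
      (∀ M ∈ 𝓜, expRegret M A' T ≤ 22 * (R + (√T + δ * T))) ∧
      expRegret Mbar A' T ≤ 258 * ((Nat.log 4 T + 1) * R + 2 * (√T + δ * T)) := by
  set S : ℝ := √T + δ * T with hS
  set J := Nat.log 4 T
  have hδT : 0 ≤ δ * T := by positivity
  have hsq : √(T : ℝ) ^ 2 = T := Real.sq_sqrt (Nat.cast_nonneg T)
  have hTS : √(T : ℝ) ≤ S := by linarith
  have hS0 : 0 ≤ S := (Real.sqrt_nonneg _).trans hTS
  have h1 : (2 : ℝ) ^ J ≤ S := by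
    refine le_trans (Real.le_sqrt_of_sq_le ?_) hTS
    rw [← four_pow_eq]
    exact_mod_cast Nat.pow_log_le_self 4 (by omega)
  have h2 : (T : ℝ) ≤ S ^ 2 := hsq.symm.le.trans (pow_le_pow_left₀ (Real.sqrt_nonneg _) hTS 2)
  have h3 : (T : ℝ) ≤ S * 2 ^ (J + 1) := by
    have h4 : √(T : ℝ) ≤ 2 ^ (J + 1) := by
      refine Real.sqrt_le_iff.2 ⟨by positivity, ?_⟩
      rw [← four_pow_eq]
      exact_mod_cast (Nat.lt_pow_succ_log_self (by norm_num) T).le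
    calc (T : ℝ) = √T * √T := by rw [← hsq, sq]; simp
      _ ≤ S * 2 ^ (J + 1) := by gcongr
  have hf := fm_mem_Icc Mbar Mbar.opt
  obtain ⟨ry⟩ := nonempty_of_isProbabilityMeasure (Mbar.k Mbar.opt)
  set b : ℝ := max (fm Mbar Mbar.opt - δ) 0
  have hB := classBudget_switchParams A Mbar.opt b hR h1 h2 h3
  have hB' := refBudget_switchParams A Mbar.opt (δ := δ) b hR h1 h2
    (by linarith [Real.sqrt_nonneg (T : ℝ)])
  refine ⟨((switchParams A Mbar.opt J R S b).toStateAlg fun _ => (Mbar.opt, ry)).toRegAlg,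
    fun M hM' => ?_, ?_⟩
  · refine (hB.expRegret_le (hA M hM') (le_max_right _ _) (max_le ?_ (fm_mem_Icc M _).1) _).trans
      (le_of_eq ?_)
    · linarith [hM M hM']
    · simp only [classLevel, pow_zero]; ring
  · refine (hB'.expRegret_le hδ.le (sub_self _) (max_le (by linarith [hf.2]) zero_le_one) ?_
      _).trans (refLevel_zero_le hS0 J)
    have := le_max_left (fm Mbar Mbar.opt - δ) 0
    change _ ≤ b + δ
    linarith

lemma log_four_add_one_le {T : ℕ} (hT : 2 ≤ T) : (Nat.log 4 T + 1 : ℝ) ≤ 3 * Real.log T := by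
  have h2 := Real.log_two_gt_d9
  have hT0 : (0 : ℝ) < T := by positivity
  have h1 : (4 : ℝ) ^ Nat.log 4 T ≤ T := by exact_mod_cast Nat.pow_log_le_self 4 (by omega)
  have h3 := Real.log_le_log (by positivity) h1
  have h4 : Real.log 4 = 2 * Real.log 2 := by
    rw [show (4 : ℝ) = 2 ^ 2 by norm_num, Real.log_pow]; norm_num
  have h5 : Real.log 2 ≤ Real.log T := Real.log_le_log (by norm_num) (by exact_mod_cast hT)
  rw [Real.log_pow, h4] at h3
  have h6 : (0 : ℝ) ≤ Nat.log 4 T := Nat.cast_nonneg _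
  nlinarith

end Minimax

end

/-- adding a near-optimal reference model to the class. -/
theorem add_reference_model :
    ∃ C : ℝ, 0 < C ∧
      ∀ (X Y : Type) [MeasurableSpace X] [MeasurableSpace Y] [Nonempty X]
        (𝓜 : Set (Model X Y)) (T : ℕ) (δ : ℝ) (Mbar : Model X Y), 0 < δ →
        (∀ M ∈ 𝓜, fm Mbar Mbar.opt ≤ fm M M.opt + δ) →
        (⨅ A : RegAlg X Y, ⨆ M ∈ 𝓜 ∪ {Mbar}, expRegret M A T) ≤
          C * Real.log (T : ℝ) * (⨅ A : RegAlg X Y, ⨆ M ∈ 𝓜, expRegret M A T)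
            + C * (Real.sqrt (T : ℝ) + δ * (T : ℝ)) := by
  refine ⟨774, by norm_num, ?_⟩
  intro X Y _ _ _ 𝓜 T δ Mbar hδ hM
  have hδT : 0 ≤ δ * T := by positivity
  have hinf (A : RegAlg X Y) : (⨅ A : RegAlg X Y, ⨆ M ∈ 𝓜 ∪ {Mbar}, expRegret M A T) ≤
      ⨆ M ∈ 𝓜 ∪ {Mbar}, expRegret M A T := by
    refine ciInf_le ⟨0, ?_⟩ A
    rintro _ ⟨A, rfl⟩
    exact iSup_expRegret_nonneg _ A T
  obtain hT | hT := lt_or_ge T 2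
  · refine (hinf (Classical.arbitrary _)).trans
      ((iSup_expRegret_le (Nat.cast_nonneg T) fun M _ => (expRegret_mem_Icc M _ T).2).trans ?_)
    interval_cases T
    · simp
    · simp only [Nat.cast_one, Real.log_one, Real.sqrt_one] at *
      linarith
  have hlog := log_four_add_one_le hT
  have hlog1 : 1 ≤ 3 * Real.log T := le_trans (by simp) hlog
  have hsqrt := Real.sqrt_nonneg (T : ℝ)
  have key (A : RegAlg X Y) : (⨅ A : RegAlg X Y, ⨆ M ∈ 𝓜 ∪ {Mbar}, expRegret M A T) ≤
      774 * Real.log T * (⨆ M ∈ 𝓜, expRegret M A T) + 774 * (√T + δ * T) := by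
    have hR := iSup_expRegret_nonneg 𝓜 A T
    obtain ⟨A', h1, h2⟩ := exists_regAlg_union_singleton (by omega) hδ hM A hR
      fun M hM => expRegret_le_iSup A T hM
    set R := ⨆ M ∈ 𝓜, expRegret M A T
    have h3 := mul_le_mul_of_nonneg_right hlog hR
    have h4 := mul_le_mul_of_nonneg_right hlog1 hR
    refine (hinf A').trans (iSup_expRegret_le (by nlinarith) ?_)
    rintro M (hM | rfl)
    · refine (h1 M hM).trans ?_
      linarith
    · refine h2.trans ?_
      linarith
  have hpos : 0 < 774 * Real.log T := by linarith
  rw [← sub_le_iff_le_add, ← div_le_iff₀' hpos]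
  refine le_ciInf fun A => ?_
  rw [div_le_iff₀' hpos, sub_le_iff_le_add]
  exact key A
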